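/- arXiv:1208.1052 — 9 statements merged into one kernel-verified Lean document; each statement's English description precedes it below -/
import Mathlib

section
/- For all k ≥ 1 and all n ≥ 1, the polynomials A_n^{(k)}(x) satisfy the recursion A_n^{(k)}(x) = A_{n−1}^{(k)}(x) + x · Σ_{i=1}^{n−1} A_{i−1}^{(k)}(x) · A_{n−i}^{(k−1)}(x), with the convention A_0^{(k)}(x) = 1 for every k ≥ 0. -/
/-- σ avoids the pattern 231: no indices i < j < k with σ k < σ i < σ j. -/
def avoids231 {n : ℕ} (σ : Equiv.Perm (Fin n)) : Prop :=
  ¬ ∃ i j k : Fin n, i < j ∧ j < k ∧ σ k < σ i ∧ σ i < σ j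

/-- The number of descents of σ : positions i with σ i > σ (i+1). -/
noncomputable def des {n : ℕ} (σ : Equiv.Perm (Fin n)) : ℕ :=
  Nat.card {i : Fin n // ∃ h : (i : ℕ) + 1 < n, σ ⟨(i : ℕ) + 1, h⟩ < σ i}

/-- The maximum drop of σ : the maximum of i - σ i. -/
def maxDrop {n : ℕ} (σ : Equiv.Perm (Fin n)) : ℕ :=
  Finset.univ.sup fun i : Fin n => (i : ℕ) - (σ i : ℕ)

/-- a n j k : the number of 231-avoiding permutations of {1,…,n} with
j descents and maximum drop at most k. -/
noncomputable def a (n j k : ℕ) : ℕ :=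
  Nat.card {σ : Equiv.Perm (Fin n) // avoids231 σ ∧ des σ = j ∧ maxDrop σ ≤ k}

/-- The polynomial $A_n^{(k)}(x) = \sum_j a_{n,j}^{(k)} x^j$ (so $A_0^{(k)} = 1$). -/
noncomputable def Apoly (k n : ℕ) : Polynomial ℚ :=
  ∑ j ∈ Finset.range (n + 1), Polynomial.C (a n j k : ℚ) * Polynomial.X ^ j

/-- The word of `σ` as a function on `ℕ`, extended by the identity outside `{0, …, n - 1}`. -/
def word {n : ℕ} (σ : Equiv.Perm (Fin n)) (i : ℕ) : ℕ :=
  if h : i < n then (σ ⟨i, h⟩ : ℕ) else i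

theorem word_val {n : ℕ} (σ : Equiv.Perm (Fin n)) (i : Fin n) : word σ i = σ i := by
  simp [word]

theorem word_of_le {n : ℕ} (σ : Equiv.Perm (Fin n)) {i : ℕ} (h : n ≤ i) : word σ i = i := by
  simp [word, Nat.not_lt.mpr h]

theorem word_lt {n : ℕ} (σ : Equiv.Perm (Fin n)) {i : ℕ} (h : i < n) : word σ i < n := by
  simp [word, h]

theorem word_inj {n : ℕ} (σ : Equiv.Perm (Fin n)) {i j : ℕ} (hi : i < n) (hj : j < n)
    (h : word σ i = word σ j) : i = j := by
  simpa [word, hi, hj, Fin.val_inj] using h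

theorem perm_ext_word {n : ℕ} {σ τ : Equiv.Perm (Fin n)}
    (h : ∀ i < n, word σ i = word τ i) : σ = τ := by
  ext i
  rw [← word_val, ← word_val, h i i.isLt]

theorem avoids231_iff_word {n : ℕ} (σ : Equiv.Perm (Fin n)) :
    avoids231 σ ↔ ∀ i j l, i < j → j < l → l < n → word σ l < word σ i →
      word σ j ≤ word σ i := by
  unfold avoids231
  constructor
  · intro h i j l hij hjl hl h1
    by_contra! h2
    refine h ⟨⟨i, by omega⟩, ⟨j, by omega⟩, ⟨l, hl⟩, hij, hjl, ?_, ?_⟩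
    · rw [Fin.lt_def, ← word_val, ← word_val]; exact h1
    · rw [Fin.lt_def, ← word_val, ← word_val]; exact h2
  · rintro h ⟨i, j, l, hij, hjl, h1, h2⟩
    have := h i j l hij hjl l.isLt (by simpa [word_val] using h1)
    rw [word_val, word_val] at this
    exact absurd h2 (not_lt.mpr this)

theorem des_eq_sum_word {n : ℕ} (σ : Equiv.Perm (Fin n)) :
    des σ = ∑ i ∈ Finset.range n, if word σ (i + 1) < word σ i then 1 else 0 := by
  classical
  rw [des, Nat.card_eq_fintype_card, Fintype.card_subtype, Finset.card_filter,
    ← Fin.sum_univ_eq_sum_range (fun i => if word σ (i + 1) < word σ i then 1 else 0)]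
  refine Finset.sum_congr rfl fun i _ => if_congr ?_ rfl rfl
  rw [word_val]
  by_cases h : (i : ℕ) + 1 < n
  · simp [word, h, -Fin.val_fin_lt, Fin.lt_def]
  · have := (σ i).isLt
    rw [word_of_le σ (by omega)]
    simp only [h, IsEmpty.exists_iff, false_iff]
    omega

theorem des_le {n : ℕ} (σ : Equiv.Perm (Fin n)) : des σ ≤ n := by
  rw [des_eq_sum_word, ← Finset.card_filter]
  exact (Finset.card_filter_le _ _).trans_eq (Finset.card_range n)

theorem maxDrop_le_iff_word {n : ℕ} (σ : Equiv.Perm (Fin n)) (k : ℕ) :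
    maxDrop σ ≤ k ↔ ∀ i < n, i ≤ word σ i + k := by
  simp only [maxDrop, Finset.sup_le_iff, Finset.mem_univ, true_imp_iff, ← word_val,
    tsub_le_iff_left]
  exact ⟨fun h i hi => h ⟨i, hi⟩, fun h i => h i i.isLt⟩

open Classical in
theorem Apoly_eq_sum (k n : ℕ) :
    Apoly k n = ∑ σ : Equiv.Perm (Fin n) with avoids231 σ ∧ maxDrop σ ≤ k,
      (Polynomial.X : Polynomial ℚ) ^ des σ := by
  rw [← Finset.sum_fiberwise_of_maps_to (t := Finset.range (n + 1)) (g := des)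
    fun σ _ => Finset.mem_range.mpr (Nat.lt_succ_of_le (des_le σ)), Apoly]
  refine Finset.sum_congr rfl fun j _ => ?_
  rw [Finset.sum_congr rfl fun σ hσ => by rw [(Finset.mem_filter.mp hσ).2],
    Finset.sum_const, nsmul_eq_mul, a, Nat.card_eq_fintype_card, Fintype.card_subtype,
    Finset.filter_filter, Polynomial.C_eq_natCast]
  congr 3
  ext σ
  simp only [Finset.mem_filter]
  tauto

theorem Apoly_zero (k : ℕ) : Apoly k 0 = 1 := by
  classical
  have h (σ : Equiv.Perm (Fin 0)) : avoids231 σ ∧ maxDrop σ ≤ k :=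
    ⟨fun ⟨i, _⟩ => i.elim0, by simp [maxDrop]⟩
  have hd (σ : Equiv.Perm (Fin 0)) : des σ = 0 := Nat.le_zero.mp (des_le σ)
  simp [Apoly_eq_sum, h, hd]

/-- The word `L (m + r) (R + m)`, obtained from words `L` and `R` of lengths `m` and `r`. -/
def glueFun {m r : ℕ} (L : Equiv.Perm (Fin m)) (R : Equiv.Perm (Fin r)) (i : ℕ) : ℕ :=
  if i < m then word L i else if i = m then m + r else m + word R (i - (m + 1))

theorem glueFun_lt {m r : ℕ} (L : Equiv.Perm (Fin m)) (R : Equiv.Perm (Fin r)) {i : ℕ}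
    (hi : i < m + 1 + r) : glueFun L R i < m + 1 + r := by
  unfold glueFun
  split_ifs with h1 h2
  · have := word_lt L h1; omega
  · omega
  · have := word_lt R (i := i - (m + 1)) (by omega); omega

theorem glueFun_inj {m r : ℕ} (L : Equiv.Perm (Fin m)) (R : Equiv.Perm (Fin r)) {i j : ℕ}
    (hi : i < m + 1 + r) (hj : j < m + 1 + r) (h : glueFun L R i = glueFun L R j) : i = j := by
  have hL (i : ℕ) : i < m → word L i < m := word_lt L
  have hR (i : ℕ) : i < r → word R i < r := word_lt R
  have h1 := hL i
  have h2 := hL j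
  have h3 := hR (i - (m + 1))
  have h4 := hR (j - (m + 1))
  have h5 := @word_inj _ L i j
  have h6 := @word_inj _ R (i - (m + 1)) (j - (m + 1))
  unfold glueFun at h
  split_ifs at h <;> omega

/-- The permutation with word `L (m + r) (R + m)`. -/
noncomputable def glue {m r : ℕ} (L : Equiv.Perm (Fin m)) (R : Equiv.Perm (Fin r)) :
    Equiv.Perm (Fin (m + 1 + r)) :=
  Equiv.ofBijective (fun i => ⟨glueFun L R i, glueFun_lt L R i.isLt⟩) <|
    Finite.injective_iff_bijective.mp fun i j h =>
      Fin.ext (glueFun_inj L R i.isLt j.isLt (congrArg Fin.val h))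

section glue

variable {m r : ℕ} (L : Equiv.Perm (Fin m)) (R : Equiv.Perm (Fin r))

theorem word_glue {i : ℕ} (hi : i < m + 1 + r) : word (glue L R) i = glueFun L R i := by
  simp [word, hi, glue]

theorem word_glue_left {i : ℕ} (hi : i < m) : word (glue L R) i = word L i := by
  rw [word_glue L R (by omega), glueFun, if_pos hi]

theorem word_glue_mid : word (glue L R) m = m + r := by
  rw [word_glue L R (by omega), glueFun, if_neg (by omega), if_pos rfl]

theorem word_glue_right {i : ℕ} (hi : i < r) : word (glue L R) (m + 1 + i) = m + word R i := by
  rw [word_glue L R (by omega), glueFun, if_neg (by omega), if_neg (by omega),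
    Nat.add_sub_cancel_left]

theorem maxDrop_glue_le_iff {k : ℕ} (hk : 1 ≤ k) :
    maxDrop (glue L R) ≤ k ↔ maxDrop L ≤ k ∧ maxDrop R ≤ k - 1 := by
  simp only [maxDrop_le_iff_word]
  constructor
  · refine fun h => ⟨fun i hi => ?_, fun i hi => ?_⟩
    · have := h i (by omega)
      rwa [word_glue_left L R hi] at this
    · have := h (m + 1 + i) (by omega)
      rw [word_glue_right L R hi] at this
      omega
  · rintro ⟨h1, h2⟩ i hi
    rcases lt_trichotomy i m with h | rfl | h
    · rw [word_glue_left L R h]; exact h1 i h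
    · rw [word_glue_mid]; omega
    · obtain ⟨j, rfl⟩ := Nat.exists_eq_add_of_le (Nat.succ_le_of_lt h)
      rw [Nat.succ_eq_add_one, word_glue_right L R (by omega)]
      have := h2 j (by omega)
      omega

theorem avoids231_glue_iff : avoids231 (glue L R) ↔ avoids231 L ∧ avoids231 R := by
  simp only [avoids231_iff_word]
  constructor
  · refine fun h => ⟨fun i j l hij hjl hl hli => ?_, fun i j l hij hjl hl hli => ?_⟩
    · have := h i j l hij hjl (by omega)
      rw [word_glue_left L R hl, word_glue_left L R (hjl.trans hl),
        word_glue_left L R (hij.trans (hjl.trans hl))] at this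
      exact this hli
    · have := h (m + 1 + i) (m + 1 + j) (m + 1 + l) (by omega) (by omega) (by omega)
      rw [word_glue_right L R hl, word_glue_right L R (hjl.trans hl),
        word_glue_right L R (hij.trans (hjl.trans hl))] at this
      omega
  · rintro ⟨h1, h2⟩ i j l hij hjl hl
    rw [word_glue L R hl, word_glue L R (hjl.trans hl), word_glue L R (hij.trans (hjl.trans hl))]
    have h3 := h1 i j l hij hjl
    have h4 := h2 (i - (m + 1)) (j - (m + 1)) (l - (m + 1))
    have h5 := @word_lt _ L i
    have h6 := @word_lt _ R (j - (m + 1))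
    have h7 := @word_lt _ R (l - (m + 1))
    unfold glueFun
    split_ifs <;> omega

theorem des_glue : des (glue L R) = des L + des R + if r = 0 then 0 else 1 := by
  have hL : ∀ i ∈ Finset.range m,
      (if word (glue L R) (i + 1) < word (glue L R) i then 1 else 0) =
        if word L (i + 1) < word L i then 1 else 0 := by
    intro i hi
    rw [Finset.mem_range] at hi
    have := word_lt L hi
    rw [word_glue_left L R hi]
    rcases Nat.lt_or_ge (i + 1) m with h | h
    · rw [word_glue_left L R h]
    · obtain rfl : m = i + 1 := by omega
      rw [word_glue_mid, word_of_le L le_rfl, if_neg (by omega), if_neg (by omega)]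
  have hR : ∀ i ∈ Finset.range r,
      (if word (glue L R) (m + 1 + i + 1) < word (glue L R) (m + 1 + i) then 1 else 0) =
        if word R (i + 1) < word R i then 1 else 0 := by
    intro i hi
    rw [Finset.mem_range] at hi
    have := word_lt R hi
    rw [word_glue_right L R hi, add_assoc (m + 1) i 1]
    rcases Nat.lt_or_ge (i + 1) r with h | h
    · rw [word_glue_right L R h]
      simp
    · rw [word_of_le R h, word_of_le _ (by omega), if_neg (by omega), if_neg (by omega)]
  have hm : (if word (glue L R) (m + 1) < word (glue L R) m then 1 else 0) =
      if r = 0 then 0 else 1 := by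
    rw [word_glue_mid]
    split_ifs with h1 h2 h2
    · rw [word_of_le _ (by omega)] at h1; omega
    · rfl
    · rfl
    · have h3 := word_glue_right L R (i := 0) (by omega)
      have h4 := word_lt R (i := 0) (by omega)
      rw [add_zero] at h3
      omega
  rw [des_eq_sum_word, des_eq_sum_word, des_eq_sum_word, Finset.sum_range_add,
    Finset.sum_range_succ, Finset.sum_congr rfl hL, Finset.sum_congr rfl hR, hm]
  omega

end glue

theorem glue_injective {m r : ℕ} {L L' : Equiv.Perm (Fin m)} {R R' : Equiv.Perm (Fin r)}
    (h : glue L R = glue L' R') : L = L' ∧ R = R' := by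
  constructor
  · refine perm_ext_word fun i hi => ?_
    rw [← word_glue_left L R hi, h, word_glue_left L' R' hi]
  · refine perm_ext_word fun i hi => ?_
    have := word_glue_right L R hi
    rw [h, word_glue_right L' R' hi] at this
    omega

theorem exists_glue_eq {m r : ℕ} {σ : Equiv.Perm (Fin (m + 1 + r))} (hσ : avoids231 σ)
    (hm : word σ m = m + r) : ∃ L R, glue L R = σ := by
  rw [avoids231_iff_word] at hσ
  have hne {i : ℕ} (hi : i < m + 1 + r) (him : i ≠ m) : word σ i < m + r := by
    have h1 := word_lt σ hi
    have h2 : word σ i ≠ m + r := fun h => him (word_inj σ hi (by omega) (h.trans hm.symm))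
    omega
  have hlt {i l : ℕ} (hi : i < m) (hml : m < l) (hl : l < m + 1 + r) : word σ i < word σ l := by
    have h1 := hσ i m l hi hml hl
    have h2 := hne (i := i) (by omega) (by omega)
    have h3 := @word_inj _ σ i l
    omega
  have hleft {i : ℕ} (hi : i < m) : word σ i < m := by
    have hc := Finset.card_le_card_of_injOn (s := Finset.Ioo m (m + 1 + r))
      (t := Finset.Ioo (word σ i) (m + r)) (word σ)
      (fun l hl => by
        have hl := Finset.mem_Ioo.mp hl
        exact Finset.mem_coe.mpr (Finset.mem_Ioo.mpr
          ⟨hlt hi hl.1 hl.2, hne hl.2 (by omega)⟩))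
      (fun l hl l' hl' h => word_inj σ (Finset.mem_Ioo.mp hl).2 (Finset.mem_Ioo.mp hl').2 h)
    have := hne (i := i) (by omega) (by omega)
    simp only [Nat.card_Ioo] at hc
    omega
  have hright {l : ℕ} (hml : m < l) (hl : l < m + 1 + r) : m ≤ word σ l := by
    have hc := Finset.card_le_card_of_injOn (s := Finset.range m)
      (t := Finset.range (word σ l)) (word σ)
      (fun i hi => Finset.mem_coe.mpr (Finset.mem_range.mpr
        (hlt (Finset.mem_range.mp hi) hml hl)))
      (fun i hi j hj h => by
        have hi := Finset.mem_range.mp hi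
        have hj := Finset.mem_range.mp hj
        exact word_inj σ (by omega) (by omega) h)
    simpa using hc
  have hr (i : Fin r) : m ≤ word σ (m + 1 + i) ∧ word σ (m + 1 + i) < m + r :=
    ⟨hright (by omega) (by omega), hne (by omega) (by omega)⟩
  let L : Equiv.Perm (Fin m) :=
    Equiv.ofBijective (fun i => ⟨word σ i, hleft i.isLt⟩) <|
      Finite.injective_iff_bijective.mp fun i j h =>
        Fin.ext (word_inj σ (by omega) (by omega) (congrArg Fin.val h))
  let R : Equiv.Perm (Fin r) :=
    Equiv.ofBijective (fun i => ⟨word σ (m + 1 + i) - m, by have := hr i; omega⟩) <|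
      Finite.injective_iff_bijective.mp fun i j h => by
        have h1 := congrArg Fin.val h
        have h2 := hr i
        have h3 := hr j
        have h4 := @word_inj _ σ (m + 1 + i) (m + 1 + j) (by omega) (by omega)
        simp only at h1
        omega
  refine ⟨L, R, perm_ext_word fun i hi => ?_⟩
  rcases lt_trichotomy i m with h | rfl | h
  · rw [word_glue_left L R h]
    simp [word, h, L, hi]
  · rw [word_glue_mid, hm]
  · obtain ⟨j, rfl⟩ := Nat.exists_eq_add_of_le (Nat.succ_le_of_lt h)
    have hj : j < r := by omega
    have hrj := hr ⟨j, hj⟩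
    have hR : word R j = word σ (m + 1 + j) - m := by
      conv_lhs => rw [word, dif_pos hj]
      rfl
    rw [Nat.succ_eq_add_one, word_glue_right L R hj, hR]
    simp only at hrj
    omega

open Classical in
theorem sum_word_eq_max {n m r k : ℕ} (hn : n = m + 1 + r) (hk : 1 ≤ k) :
    (∑ σ : Equiv.Perm (Fin n) with (avoids231 σ ∧ maxDrop σ ≤ k) ∧ word σ m = m + r,
      (Polynomial.X : Polynomial ℚ) ^ des σ) =
      Apoly k m * Apoly (k - 1) r * Polynomial.X ^ (if r = 0 then 0 else 1) := by
  subst hn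
  rw [Apoly_eq_sum, Apoly_eq_sum, Finset.sum_mul_sum, ← Finset.sum_product', Finset.sum_mul]
  symm
  refine Finset.sum_bij (fun p _ => glue p.1 p.2) ?_ ?_ ?_ ?_
  · rintro ⟨L, R⟩ h
    simp only [Finset.mem_product, Finset.mem_filter, Finset.mem_univ, true_and] at h ⊢
    rw [avoids231_glue_iff, maxDrop_glue_le_iff L R hk, word_glue_mid]
    tauto
  · rintro ⟨L, R⟩ _ ⟨L', R'⟩ _ h
    exact Prod.ext_iff.mpr (glue_injective h)
  · intro σ h
    simp only [Finset.mem_filter, Finset.mem_univ, true_and] at h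
    obtain ⟨⟨h1, h2⟩, h3⟩ := h
    obtain ⟨L, R, rfl⟩ := exists_glue_eq h1 h3
    rw [avoids231_glue_iff] at h1
    rw [maxDrop_glue_le_iff L R hk] at h2
    refine ⟨(L, R), ?_, rfl⟩
    simp only [Finset.mem_product, Finset.mem_filter, Finset.mem_univ, true_and]
    tauto
  · rintro ⟨L, R⟩ _
    rw [des_glue, pow_add, pow_add]

theorem Apoly_succ_eq_sum_range (N : ℕ) {k : ℕ} (hk : 1 ≤ k) :
    Apoly k (N + 1) = ∑ m ∈ Finset.range (N + 1),
      Apoly k m * Apoly (k - 1) (N - m) * Polynomial.X ^ (if N - m = 0 then 0 else 1) := by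
  classical
  rw [Apoly_eq_sum, ← Finset.sum_fiberwise_of_maps_to (t := Finset.range (N + 1))
    (g := fun σ : Equiv.Perm (Fin (N + 1)) => (σ.symm (Fin.last N) : ℕ))
    fun σ _ => Finset.mem_range.mpr (σ.symm (Fin.last N)).isLt]
  refine Finset.sum_congr rfl fun m hm => ?_
  rw [Finset.mem_range] at hm
  rw [← sum_word_eq_max (n := N + 1) (by omega) hk, Finset.filter_filter]
  refine Finset.sum_congr (Finset.filter_congr fun σ _ => and_congr_right fun _ => ?_)
    fun _ _ => rfl
  have h : word σ m = σ ⟨m, hm⟩ := word_val σ ⟨m, hm⟩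
  have h2 : m + (N - m) = (Fin.last N : Fin (N + 1)) := by simp; omega
  rw [h, h2, Fin.val_inj, ← Equiv.eq_symm_apply, Fin.ext_iff, eq_comm]

theorem Apoly_recursion (k n : ℕ) (hk : 1 ≤ k) (hn : 1 ≤ n) :
    Apoly k n =
      Apoly k (n - 1) +
        Polynomial.X * ∑ i ∈ Finset.Icc 1 (n - 1), Apoly k (i - 1) * Apoly (k - 1) (n - i) := by
  obtain ⟨N, rfl⟩ := Nat.exists_eq_add_of_le' hn
  rw [Apoly_succ_eq_sum_range N hk, Finset.sum_range_succ, Nat.sub_self, Apoly_zero,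
    if_pos rfl, pow_zero, mul_one, mul_one, Nat.add_sub_cancel, Finset.mul_sum,
    ← Finset.Ico_add_one_right_eq_Icc, Finset.sum_Ico_eq_sum_range, Nat.add_sub_cancel]
  refine (add_comm _ _).trans (congrArg (Apoly k N + ·) (Finset.sum_congr rfl fun m hm => ?_))
  rw [Finset.mem_range] at hm
  rw [if_neg (by omega), pow_one, mul_comm, Nat.add_sub_cancel_left,
    show N + 1 - (1 + m) = N - m by omega]
end

section
/- For all n ≥ 1, the number of 231-avoiding permutations σ of {1,…,n} with maximum drop md(σ) ≤ 1 equals 2^{n−1}. -/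
theorem maxDrop_le_iff {n : ℕ} (σ : Equiv.Perm (Fin n)) (k : ℕ) :
    maxDrop σ ≤ k ↔ ∀ i : Fin n, (i : ℕ) ≤ σ i + k := by
  simp only [maxDrop, Finset.sup_le_iff, Finset.mem_univ, true_imp_iff]
  exact forall_congr' fun i => by omega

/-- A permutation in which no entry lies more than one place to the right of its value
avoids 231. -/
theorem avoids231_of_maxDrop_le_one {n : ℕ} {σ : Equiv.Perm (Fin n)} (h : maxDrop σ ≤ 1) :
    avoids231 σ := by
  rw [maxDrop_le_iff] at h
  rintro ⟨i, j, k, hij, hjk, hki, hij'⟩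
  have hk := h k
  have hmaps : ∀ v ∈ insert (σ i) (insert (σ j) (Finset.Iio (σ k))),
      σ.symm v ∈ Finset.Iic (σ k) := by
    intro v hv
    simp only [Finset.mem_insert, Finset.mem_Iio] at hv
    rw [Finset.mem_Iic, Fin.le_def]
    rcases hv with rfl | rfl | hv
    · rw [Equiv.symm_apply_apply]; omega
    · rw [Equiv.symm_apply_apply]; omega
    · have := h (σ.symm v)
      rw [Equiv.apply_symm_apply] at this
      omega
  have hcard := Finset.card_le_card_of_injOn _ hmaps σ.symm.injective.injOn
  rw [Finset.card_insert_of_notMem, Finset.card_insert_of_notMem, Fin.card_Iio,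
    Fin.card_Iic] at hcard
  · omega
  · simp only [Finset.mem_Iio]; omega
  · simp only [Finset.mem_insert, Finset.mem_Iio]; omega

theorem maxDrop_inv_le_iff {n : ℕ} (σ : Equiv.Perm (Fin n)) (k : ℕ) :
    maxDrop σ⁻¹ ≤ k ↔ ∀ i : Fin n, (σ i : ℕ) ≤ i + k := by
  rw [maxDrop_le_iff, ← σ.forall_congr_right]
  simp

theorem maxDrop_inv_decomposeFin_symm_le_one_iff {n : ℕ} (p : Fin (n + 1))
    (e : Equiv.Perm (Fin n)) :
    maxDrop (Equiv.Perm.decomposeFin.symm (p, e))⁻¹ ≤ 1 ↔ (p : ℕ) ≤ 1 ∧ maxDrop e⁻¹ ≤ 1 := by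
  rw [maxDrop_inv_le_iff, maxDrop_inv_le_iff, Fin.forall_fin_succ]
  simp only [Equiv.Perm.decomposeFin_symm_apply_zero, Equiv.Perm.decomposeFin_symm_apply_succ,
    Fin.val_zero, zero_add, Fin.val_succ]
  refine and_congr_right fun hp => forall_congr' fun i => ?_
  rw [Equiv.swap_apply_def, if_neg (Fin.succ_ne_zero _)]
  split_ifs with h
  · have : (e i : ℕ) + 1 = p := by rw [← h, Fin.val_succ]
    simp only [Fin.val_zero]
    omega
  · rw [Fin.val_succ]
    omega

theorem card_maxDrop_inv_le_one (n : ℕ) :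
    Nat.card {σ : Equiv.Perm (Fin (n + 1)) // maxDrop σ⁻¹ ≤ 1} = 2 ^ n := by
  induction n with
  | zero =>
    have : ∀ σ : Equiv.Perm (Fin 1), maxDrop σ⁻¹ ≤ 1 := fun σ => by
      rw [maxDrop_inv_le_iff]
      intro i
      omega
    rw [Nat.card_congr (Equiv.subtypeUnivEquiv this), Nat.card_perm]
    simp
  | succ n ih =>
    have hp : Nat.card {p : Fin (n + 2) // (p : ℕ) ≤ 1} = 2 := by
      rw [Nat.card_eq_fintype_card, Fintype.card_subtype]
      have : ({p | (p : ℕ) ≤ 1} : Finset (Fin (n + 2))) = Finset.Iic 1 := by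
        ext p
        simp [Fin.le_def]
      rw [this, Fin.card_Iic, Fin.val_one]
    have e : {σ : Equiv.Perm (Fin (n + 2)) // maxDrop σ⁻¹ ≤ 1} ≃
        {q : Fin (n + 2) × Equiv.Perm (Fin (n + 1)) // (q.1 : ℕ) ≤ 1 ∧ maxDrop q.2⁻¹ ≤ 1} :=
      Equiv.Perm.decomposeFin.subtypeEquiv fun σ => by
        rw [← maxDrop_inv_decomposeFin_symm_le_one_iff, Prod.mk.eta, Equiv.symm_apply_apply]
    rw [Nat.card_congr (e.trans (Equiv.subtypeProdEquivProd
      (p := fun p : Fin (n + 2) => (p : ℕ) ≤ 1)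
      (q := fun e : Equiv.Perm (Fin (n + 1)) => maxDrop e⁻¹ ≤ 1))),
      Nat.card_prod, hp, ih, pow_succ']

theorem card_maxDrop_le_one (n : ℕ) (hn : 1 ≤ n) :
    Nat.card {σ : Equiv.Perm (Fin n) // avoids231 σ ∧ maxDrop σ ≤ 1} = 2 ^ (n - 1) := by
  obtain ⟨m, rfl⟩ := Nat.exists_eq_add_of_le' hn
  rw [Nat.add_sub_cancel, ← card_maxDrop_inv_le_one]
  exact Nat.card_congr ((Equiv.inv _).subtypeEquiv fun σ => by
    rw [Equiv.inv_apply, inv_inv]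
    exact and_iff_right_of_imp avoids231_of_maxDrop_le_one)
end

section
/- For all r ≥ 1 and all n ≥ 2r, the number of 231-avoiding permutations σ of {1,…,n} with des(σ) = r and md(σ) ≤ 1 equals the binomial coefficient C(n, 2r). -/
/-- `IsDrop σ i` : the position `i` is a drop of `σ`, that is, `σ i < i`. -/
def IsDrop {n : ℕ} (σ : Equiv.Perm (Fin n)) (i : ℕ) : Prop :=
  ∃ h : i < n, (σ ⟨i, h⟩ : ℕ) < i

theorem maxDrop_le_one_iff {n : ℕ} (σ : Equiv.Perm (Fin n)) :
    maxDrop σ ≤ 1 ↔ ∀ i : Fin n, (i : ℕ) ≤ (σ i : ℕ) + 1 := by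
  simp only [maxDrop, Finset.sup_le_iff, Finset.mem_univ, true_implies, Nat.sub_le_iff_le_add,
    add_comm 1]

theorem isDrop_coe {n : ℕ} {σ : Equiv.Perm (Fin n)} {i : Fin n} :
    IsDrop σ i ↔ (σ i : ℕ) < i :=
  ⟨fun ⟨_, h⟩ => h, fun h => ⟨i.2, h⟩⟩

section OneDrop

variable {n : ℕ} {σ : Equiv.Perm (Fin n)}

theorem apply_lt_of_not_drop (hσ : ∀ i : Fin n, (i : ℕ) ≤ (σ i : ℕ) + 1) {i m : Fin n}
    (him : i < m) (hm : m ≤ σ m) : σ i < m := by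
  have hmaps : ∀ x ∈ Finset.Ici m, σ x ∈ Finset.Ici m := by
    intro x hx
    rw [Finset.mem_Ici] at hx ⊢
    rcases hx.eq_or_lt with rfl | hx
    · exact hm
    · have := hσ x
      rw [Fin.le_def]
      rw [Fin.lt_def] at hx
      omega
  by_contra! hcon
  obtain ⟨x, hx, hxi⟩ := Finset.surjOn_of_injOn_of_card_le σ hmaps σ.injective.injOn le_rfl
    (Finset.mem_coe.2 (Finset.mem_Ici.2 hcon))
  rw [σ.injective hxi, Finset.mem_coe, Finset.mem_Ici] at hx
  exact absurd him (not_lt.2 hx)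

theorem drop_of_le_apply (hσ : ∀ i : Fin n, (i : ℕ) ≤ (σ i : ℕ) + 1) {i m : Fin n}
    (him : i < m) (hm : m ≤ σ i) : σ m < m := by
  by_contra! h
  exact absurd (apply_lt_of_not_drop hσ him h) (not_lt.2 hm)

theorem avoids231_of_maxDrop_le_one_s3 (hσ : ∀ i : Fin n, (i : ℕ) ≤ (σ i : ℕ) + 1) :
    avoids231 σ := by
  rintro ⟨i, j, k, hij, hjk, hki, hij'⟩
  rcases le_or_gt k (σ k) with hk | hk
  · exact absurd ((apply_lt_of_not_drop hσ (hij.trans hjk) hk).trans_le hk) hki.asymm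
  · have h1 := hσ k
    have h2 : σ j < j := drop_of_le_apply hσ hij (by
      simp only [Fin.lt_def, Fin.le_def] at *
      omega)
    simp only [Fin.lt_def] at *
    omega

theorem apply_lt_apply_iff_drop (hσ : ∀ i : Fin n, (i : ℕ) ≤ (σ i : ℕ) + 1) (i : Fin n) :
    (∃ h : (i : ℕ) + 1 < n, σ ⟨(i : ℕ) + 1, h⟩ < σ i) ↔
      ¬ IsDrop σ i ∧ IsDrop σ (i + 1) := by
  rw [isDrop_coe]
  constructor
  · rintro ⟨h, hlt⟩
    have h1 := hσ ⟨i + 1, h⟩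
    refine ⟨fun hi => ?_, h, ?_⟩
    · simp only [Fin.lt_def] at hlt h1
      omega
    · by_contra! hcon
      have := apply_lt_of_not_drop hσ (i := i) (m := ⟨i + 1, h⟩) (by simp [Fin.lt_def])
        (by simpa [Fin.le_def] using hcon)
      simp only [Fin.lt_def] at hlt this
      omega
  · rintro ⟨hi, h, hlt⟩
    refine ⟨h, lt_of_le_of_ne ?_ fun he => ?_⟩
    · rw [Fin.le_def]
      omega
    · have := congrArg Fin.val (σ.injective he)
      simp at this

theorem apply_le_of_isDrop_iff {τ : Equiv.Perm (Fin n)}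
    (hσ : ∀ i : Fin n, (i : ℕ) ≤ (σ i : ℕ) + 1) (hτ : ∀ i : Fin n, (i : ℕ) ≤ (τ i : ℕ) + 1)
    (h : ∀ i, IsDrop σ i ↔ IsDrop τ i) (i : Fin n) : τ i ≤ σ i := by
  have hi := h i
  have hσi := hσ i
  have hτi := hτ i
  rw [isDrop_coe, isDrop_coe] at hi
  by_contra! hlt
  rw [Fin.lt_def] at hlt
  have hm : (σ i : ℕ) + 1 < n := by omega
  have hdrop : τ ⟨σ i + 1, hm⟩ < ⟨σ i + 1, hm⟩ :=
    drop_of_le_apply hτ (i := i) (by rw [Fin.lt_def]; simp only; omega)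
      (by rw [Fin.le_def]; simp only; omega)
  obtain ⟨_, hdrop'⟩ := (h (σ i + 1)).2 ⟨hm, hdrop⟩
  have hσm := hσ ⟨σ i + 1, hm⟩
  simp only at hσm
  have heq : σ ⟨σ i + 1, hm⟩ = σ i := Fin.ext (by omega)
  have := congrArg Fin.val (σ.injective heq)
  simp only at this
  omega

theorem eq_of_isDrop_iff {τ : Equiv.Perm (Fin n)}
    (hσ : ∀ i : Fin n, (i : ℕ) ≤ (σ i : ℕ) + 1) (hτ : ∀ i : Fin n, (i : ℕ) ≤ (τ i : ℕ) + 1)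
    (h : ∀ i, IsDrop σ i ↔ IsDrop τ i) : σ = τ :=
  Equiv.ext fun i => le_antisymm (apply_le_of_isDrop_iff hτ hσ (fun j => (h j).symm) i)
    (apply_le_of_isDrop_iff hσ hτ h i)

end OneDrop

theorem exists_perm_isDrop_iff {n : ℕ} {S : ℕ → Prop} (h0 : ¬ S 0) (hn : ∀ i, n ≤ i → ¬ S i) :
    ∃ σ : Equiv.Perm (Fin n), (∀ i : Fin n, (i : ℕ) ≤ (σ i : ℕ) + 1) ∧
      ∀ i, IsDrop σ i ↔ S i := by
  classical
  have hend : ∀ i : Fin n, ∃ j : Fin n, (i ≤ j ∧ ¬ S (j + 1)) ∧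
      ∀ m : ℕ, (i : ℕ) < m → m ≤ j → S m := by
    intro i
    have hex : ∃ j, (i : ℕ) ≤ j ∧ ¬ S (j + 1) := ⟨n, i.2.le, hn _ (by omega)⟩
    have hle : Nat.find hex ≤ n - 1 :=
      Nat.find_min' hex ⟨by omega, hn _ (by omega)⟩
    refine ⟨⟨Nat.find hex, by omega⟩, Nat.find_spec hex, fun m him hm => ?_⟩
    have := Nat.find_min hex (m := m - 1) (by simp only at hm; omega)
    rw [Nat.sub_add_cancel (by omega)] at this
    by_contra hS
    exact this ⟨by omega, hS⟩
  choose e he hemin using hend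
  let f : Fin n → Fin n := fun i => if S i then ⟨i - 1, by omega⟩ else e i
  have hpos : ∀ i, S i → 0 < i := fun i hi => Nat.pos_of_ne_zero fun h => h0 (h ▸ hi)
  have hmixed : ∀ i j : Fin n, S i → (⟨i - 1, by omega⟩ : Fin n) ≠ e j := by
    intro i j hi heq
    have := (he j).2
    rw [← heq] at this
    simp only [Nat.sub_add_cancel (hpos i hi)] at this
    exact this hi
  have hmono : ∀ i j : Fin n, ¬ S j → i < j → e i ≠ e j := by
    intro i j hj hij heq
    exact hj (hemin i j hij (heq ▸ (he j).1))
  have hinj : Function.Injective f := by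
    intro i j hij
    by_cases hi : S i <;> by_cases hj : S j <;> simp only [f, hi, hj, if_true, if_false] at hij
    · have := congrArg Fin.val hij
      have := hpos i hi
      have := hpos j hj
      simp only at *
      omega
    · exact absurd hij (hmixed i j hi)
    · exact absurd hij.symm (hmixed j i hj)
    · rcases lt_trichotomy i j with h | h | h
      · exact absurd hij (hmono i j hj h)
      · exact h
      · exact absurd hij.symm (hmono j i hi h)
  have hf : ∀ i : Fin n, (i : ℕ) ≤ (f i : ℕ) + 1 ∧ ((f i : ℕ) < i ↔ S i) := by
    intro i
    by_cases hi : S i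
    · have := hpos i hi
      simp only [f, hi, if_true, iff_true]
      omega
    · have := Fin.le_def.1 (he i).1
      simp only [f, hi, if_false, iff_false]
      omega
  refine ⟨Equiv.ofBijective f (Finite.injective_iff_bijective.1 hinj), fun i => (hf i).1,
    fun i => ⟨fun ⟨h, hlt⟩ => (hf ⟨i, h⟩).2.1 hlt, fun hi => ?_⟩⟩
  have h : i < n := by
    by_contra! h
    exact hn i h hi
  exact ⟨h, (hf ⟨i, h⟩).2.2 hi⟩

open Classical in
/-- The positions `i < n` at which the predicate `S` changes its truth value. -/
noncomputable def changes (S : ℕ → Prop) (n : ℕ) : Finset ℕ :=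
  (Finset.range n).filter fun i => ¬ (S i ↔ S (i + 1))

theorem mem_changes {S : ℕ → Prop} {n i : ℕ} :
    i ∈ changes S n ↔ i < n ∧ ¬ (S i ↔ S (i + 1)) := by
  simp [changes]

open Classical in
theorem card_changes {S : ℕ → Prop} (h0 : ¬ S 0) (n : ℕ) :
    (changes S n).card + (if S n then 1 else 0) =
      2 * ((Finset.range n).filter fun i => ¬ S i ∧ S (i + 1)).card := by
  induction n with
  | zero => simp [changes, h0]
  | succ n ih =>
    simp only [changes, Finset.range_add_one, Finset.filter_insert] at ih ⊢
    by_cases h : S n <;> by_cases h' : S (n + 1) <;> simp [h, h'] at ih ⊢ <;> omega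

theorem changes_injective {S S' : ℕ → Prop} {n : ℕ} (h0 : ¬ S 0) (h0' : ¬ S' 0)
    (h : changes S n = changes S' n) : ∀ i ≤ n, (S i ↔ S' i) := by
  intro i
  induction i with
  | zero => exact fun _ => iff_of_false h0 h0'
  | succ i ih =>
    intro hi
    have h1 := ih (by omega)
    have h2 : i ∈ changes S n ↔ i ∈ changes S' n := by rw [h]
    simp only [mem_changes] at h2
    have : i < n := hi
    tauto

theorem exists_changes_eq {n : ℕ} {T : Finset ℕ} (hT : T ⊆ Finset.range n) (heven : Even T.card) :
    ∃ S : ℕ → Prop, ¬ S 0 ∧ (∀ i, n ≤ i → ¬ S i) ∧ changes S n = T := by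
  refine ⟨fun i => Odd (T.filter (· < i)).card, by simp, fun i hi => ?_, ?_⟩
  · show ¬ Odd (T.filter (· < i)).card
    rw [Finset.filter_true_of_mem fun t ht => (Finset.mem_range.1 (hT ht)).trans_le hi]
    exact Nat.not_odd_iff_even.2 heven
  · ext i
    rw [mem_changes]
    show i < n ∧ ¬ (Odd (T.filter (· < i)).card ↔ Odd (T.filter (· < i + 1)).card) ↔ i ∈ T
    by_cases hi : i ∈ T
    · have : T.filter (· < i + 1) = insert i (T.filter (· < i)) := by
        ext t
        simp only [Finset.mem_filter, Finset.mem_insert]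
        grind
      rw [this, Finset.card_insert_of_notMem (by simp), Nat.odd_add_one]
      have := Finset.mem_range.1 (hT hi)
      tauto
    · have : T.filter (· < i + 1) = T.filter (· < i) := by
        ext t
        simp only [Finset.mem_filter]
        grind
      rw [this]
      tauto

theorem not_isDrop_zero {n : ℕ} (σ : Equiv.Perm (Fin n)) : ¬ IsDrop σ 0 :=
  fun ⟨_, h⟩ => Nat.not_lt_zero _ h

theorem not_isDrop_of_le {n : ℕ} (σ : Equiv.Perm (Fin n)) {i : ℕ} (hi : n ≤ i) : ¬ IsDrop σ i :=
  fun ⟨h, _⟩ => absurd h (not_lt.2 hi)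

theorem card_changes_isDrop {n : ℕ} {σ : Equiv.Perm (Fin n)}
    (hσ : ∀ i : Fin n, (i : ℕ) ≤ (σ i : ℕ) + 1) :
    (changes (IsDrop σ) n).card = 2 * des σ := by
  classical
  have h := card_changes (not_isDrop_zero σ) n
  rw [if_neg (not_isDrop_of_le σ le_rfl), add_zero] at h
  rw [h, des, Nat.card_congr (Equiv.subtypeEquivRight (apply_lt_apply_iff_drop hσ)),
    Nat.card_eq_fintype_card, Fintype.card_subtype, Finset.card_filter, Finset.card_filter,
    Finset.sum_range]

theorem a_one_drop (r n : ℕ) (hr : 1 ≤ r) (hn : 2 * r ≤ n) :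
    a n r 1 = n.choose (2 * r) := by
  let F : {σ : Equiv.Perm (Fin n) // avoids231 σ ∧ des σ = r ∧ maxDrop σ ≤ 1} →
      Finset.powersetCard (2 * r) (Finset.range n) := fun σ =>
    ⟨changes (IsDrop σ.1) n, Finset.mem_powersetCard.2
      ⟨fun _ hi => Finset.mem_range.2 (mem_changes.1 hi).1, by
      rw [card_changes_isDrop ((maxDrop_le_one_iff _).1 σ.2.2.2), σ.2.2.1]⟩⟩
  have hF : Function.Bijective F := by
    constructor
    · intro σ τ h
      refine Subtype.ext (eq_of_isDrop_iff ((maxDrop_le_one_iff _).1 σ.2.2.2)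
        ((maxDrop_le_one_iff _).1 τ.2.2.2) fun i => ?_)
      rcases le_total i n with hi | hi
      · exact changes_injective (not_isDrop_zero _) (not_isDrop_zero _)
          (congrArg Subtype.val h) i hi
      · exact iff_of_false (not_isDrop_of_le _ hi) (not_isDrop_of_le _ hi)
    · rintro ⟨T, hT⟩
      rw [Finset.mem_powersetCard] at hT
      obtain ⟨S, h0, hS, hST⟩ := exists_changes_eq hT.1 (hT.2 ▸ even_two_mul r)
      obtain ⟨σ, hσ, hdrop⟩ := exists_perm_isDrop_iff h0 hS
      have hchanges : changes (IsDrop σ) n = T := by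
        rw [← hST, funext fun i => propext (hdrop i)]
      have hdes := card_changes_isDrop hσ
      rw [hchanges, hT.2] at hdes
      exact ⟨⟨σ, avoids231_of_maxDrop_le_one_s3 hσ, by omega, (maxDrop_le_one_iff σ).2 hσ⟩,
        Subtype.ext hchanges⟩
  rw [a, Nat.card_eq_of_bijective F hF, Nat.card_eq_fintype_card, Fintype.card_coe,
    Finset.card_powersetCard, Finset.card_range]
end

section
/- If σ is a 231-avoiding permutation of {1,…,n} with exactly one descent (des(σ) = 1), then its maximum drop satisfies md(σ) = 1. -/
theorem exists_descent_of_lt {α : Type*} [LinearOrder α] {n : ℕ} (f : Fin n → α) {i j : Fin n}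
    (hij : i < j) (hf : f j < f i) :
    ∃ d : Fin n, i ≤ d ∧ d < j ∧ ∃ h : (d : ℕ) + 1 < n, f ⟨(d : ℕ) + 1, h⟩ < f d := by
  by_contra! hcon
  have hmono : ∀ m : ℕ, (i : ℕ) ≤ m → ∀ hm : m < n, m ≤ j → f i ≤ f ⟨m, hm⟩ := by
    intro m him
    induction m, him using Nat.le_induction with
    | base => intro _ _; exact le_rfl
    | succ m him ih =>
      intro hm hmj
      exact (ih (by omega) (by omega)).trans (hcon ⟨m, by omega⟩ him hmj hm)
  exact (hmono j hij.le j.isLt le_rfl).not_gt hf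

theorem eq_of_lt_of_apply_gt {n : ℕ} {σ : Equiv.Perm (Fin n)} (havoid : avoids231 σ)
    (hdes : des σ ≤ 1) {i j k : Fin n} (hik : i < k) (hjk : j < k)
    (hi : σ k < σ i) (hj : σ k < σ j) : i = j := by
  wlog hij : i < j generalizing i j
  · rcases eq_or_lt_of_le (not_lt.mp hij) with h | h
    · exact h.symm
    · exact (this hjk hik hj hi h).symm
  exfalso
  rcases lt_or_gt_of_ne (σ.injective.ne hij.ne) with h | h
  · exact havoid ⟨i, j, k, hij, hjk, hi, h⟩
  · obtain ⟨d, _, hdj, hd⟩ := exists_descent_of_lt σ hij h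
    obtain ⟨e, hje, _, he⟩ := exists_descent_of_lt σ hjk hj
    have := Finite.card_le_one_iff_subsingleton.mp hdes
    have hde := congrArg Subtype.val (Subsingleton.elim
      (⟨d, hd⟩ : {i : Fin n // ∃ h : (i : ℕ) + 1 < n, σ ⟨(i : ℕ) + 1, h⟩ < σ i}) ⟨e, he⟩)
    exact (hdj.trans_le hje).ne hde

theorem maxDrop_le_one_of_des_le_one {n : ℕ} {σ : Equiv.Perm (Fin n)} (havoid : avoids231 σ)
    (hdes : des σ ≤ 1) : maxDrop σ ≤ 1 := by
  refine Finset.sup_le fun k _ => ?_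
  have hlarge : ((Finset.Iio k).filter fun i => σ k < σ i).card ≤ 1 := by
    refine Finset.card_le_one.mpr fun i hi j hj => ?_
    simp only [Finset.mem_filter, Finset.mem_Iio] at hi hj
    exact eq_of_lt_of_apply_gt havoid hdes hi.1 hj.1 hi.2 hj.2
  have hsmall : ((Finset.Iio k).filter fun i => ¬ σ k < σ i).card ≤ (Finset.Iio (σ k)).card := by
    refine Finset.card_le_card_of_injOn σ (fun i hi => ?_) σ.injective.injOn
    simp only [Finset.coe_filter, Finset.mem_Iio, Set.mem_ofPred_eq, not_lt] at hi
    simpa using lt_of_le_of_ne hi.2 (σ.injective.ne hi.1.ne)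
  have hsplit := Finset.card_filter_add_card_filter_not (s := Finset.Iio k) (fun i => σ k < σ i)
  rw [Fin.card_Iio] at hsplit hsmall
  omega

theorem eq_one_of_maxDrop_eq_zero {n : ℕ} {σ : Equiv.Perm (Fin n)} (h : maxDrop σ = 0) :
    σ = 1 := by
  have hle : ∀ i ∈ (Finset.univ : Finset (Fin n)), (i : ℕ) ≤ σ i := fun i hi =>
    Nat.sub_eq_zero_iff_le.mp (Finset.sup_eq_bot_iff _ _ |>.mp h i hi)
  have heq := (Finset.sum_eq_sum_iff_of_le hle).mp
    (Equiv.sum_comp σ fun i : Fin n => (i : ℕ)).symm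
  exact Equiv.ext fun i => Fin.ext (heq i (Finset.mem_univ i)).symm

theorem des_one (n : ℕ) : des (1 : Equiv.Perm (Fin n)) = 0 := by
  have : IsEmpty {i : Fin n // ∃ h : (i : ℕ) + 1 < n,
      (1 : Equiv.Perm (Fin n)) ⟨(i : ℕ) + 1, h⟩ < (1 : Equiv.Perm (Fin n)) i} := by
    refine ⟨fun ⟨i, _, hi⟩ => ?_⟩
    simp only [Equiv.Perm.one_apply, Fin.lt_def] at hi
    omega
  exact Nat.card_of_isEmpty

theorem maxDrop_eq_one_of_des_eq_one (n : ℕ) (σ : Equiv.Perm (Fin n))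
    (havoid : avoids231 σ) (hdes : des σ = 1) : maxDrop σ = 1 := by
  refine le_antisymm (maxDrop_le_one_of_des_le_one havoid hdes.le)
    (Nat.one_le_iff_ne_zero.mpr fun h => ?_)
  rw [eq_one_of_maxDrop_eq_zero h, des_one] at hdes
  exact zero_ne_one hdes
end

section
/- For all k ≥ 1 and all n ≥ 2, the number of 231-avoiding permutations σ of {1,…,n} with des(σ) = 1 and md(σ) ≤ k equals the binomial coefficient C(n, 2). -/
/-- The permutation sending `d` to `m`, shifting `d + 1, …, m` down by one and fixing the rest. -/
def intervalRotation {n : ℕ} (d m : Fin n) (h : d < m) : Equiv.Perm (Fin n) where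
  toFun i := if i = d then m else
    if d < i ∧ i ≤ m then ⟨(i : ℕ) - 1, by omega⟩ else i
  invFun i := if i = m then d else
    if h' : d ≤ i ∧ i < m then ⟨(i : ℕ) + 1, by omega⟩ else i
  left_inv i := by
    simp only [Fin.ext_iff, Fin.lt_def, Fin.le_def] at *
    split_ifs <;> simp_all <;> omega
  right_inv i := by
    simp only [Fin.ext_iff, Fin.lt_def, Fin.le_def] at *
    split_ifs <;> simp_all <;> omega

theorem intervalRotation_val {n : ℕ} {d m : Fin n} (h : d < m) (i : Fin n) :
    (intervalRotation d m h i : ℕ) =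
      if (i : ℕ) = d then (m : ℕ) else if (d : ℕ) < i ∧ (i : ℕ) ≤ m then (i : ℕ) - 1 else i := by
  simp only [intervalRotation, Equiv.coe_fn_mk, Fin.ext_iff, Fin.lt_def, Fin.le_def]
  split_ifs <;> rfl

theorem intervalRotation_symm_val {n : ℕ} {d m : Fin n} (h : d < m) (i : Fin n) :
    ((intervalRotation d m h).symm i : ℕ) =
      if (i : ℕ) = m then (d : ℕ) else if (d : ℕ) ≤ i ∧ (i : ℕ) < m then (i : ℕ) + 1 else i := by
  simp only [intervalRotation, Equiv.coe_fn_symm_mk, Fin.ext_iff, Fin.lt_def, Fin.le_def]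
  split_ifs <;> rfl

theorem avoids231_intervalRotation {n : ℕ} {d m : Fin n} (h : d < m) :
    avoids231 (intervalRotation d m h) := by
  rintro ⟨i, j, k, hij, hjk, hki, hij'⟩
  simp only [Fin.lt_def, intervalRotation_val] at *
  split_ifs at * <;> omega

theorem des_intervalRotation {n : ℕ} {d m : Fin n} (h : d < m) :
    des (intervalRotation d m h) = 1 := by
  rw [des, Nat.card_eq_one_iff_exists]
  refine ⟨⟨d, by omega, ?_⟩, ?_⟩
  · simp only [Fin.lt_def, intervalRotation_val] at *
    split_ifs <;> omega
  · rintro ⟨i, hi, hlt⟩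
    rw [Subtype.mk.injEq, Fin.ext_iff]
    simp only [Fin.lt_def, intervalRotation_val] at h hlt
    split_ifs at * <;> omega

theorem maxDrop_intervalRotation_le {n : ℕ} {d m : Fin n} (h : d < m) :
    maxDrop (intervalRotation d m h) ≤ 1 := by
  refine Finset.sup_le fun i _ => ?_
  rw [intervalRotation_val]
  split_ifs <;> omega

theorem intervalRotation_injective {n : ℕ} {d m d' m' : Fin n} (h : d < m) (h' : d' < m')
    (heq : intervalRotation d m h = intervalRotation d' m' h') : d = d' ∧ m = m' := by
  have h1 := congrArg Fin.val (Equiv.congr_fun heq d)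
  have h2 := congrArg Fin.val (Equiv.congr_fun heq d')
  simp only [Fin.ext_iff, intervalRotation_val] at *
  split_ifs at * <;> omega

theorem lt_of_forall_lt_succ {n : ℕ} {σ : Equiv.Perm (Fin n)} {i j : Fin n} (hij : i < j)
    (hσ : ∀ t : Fin n, i ≤ t → t < j → ∀ ht : (t : ℕ) + 1 < n, σ t < σ ⟨(t : ℕ) + 1, ht⟩) :
    σ i < σ j := by
  obtain ⟨j, hj⟩ := j
  replace hij : (i : ℕ) + 1 ≤ j := hij
  induction j, hij using Nat.le_induction with
  | base => exact hσ i le_rfl (Nat.lt_succ_self _) hj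
  | succ j hij ih =>
    refine (ih (by omega) fun t h1 h2 => hσ t h1 (h2.trans (Nat.lt_succ_self _))).trans ?_
    exact hσ ⟨j, by omega⟩ (Nat.le_of_succ_le hij) (Nat.lt_succ_self _) hj

theorem apply_eq_self_of_lt_later {n : ℕ} {σ : Equiv.Perm (Fin n)} {d : Fin n}
    (hσ : ∀ i j, i < d → i < j → σ i < σ j) (i : Fin n) (hi : i < d) : σ i = i := by
  induction i using WellFoundedLT.induction with
  | ind i ih =>
    rcases lt_trichotomy (σ i) i with h | h | h
    · exact σ.injective (ih _ h (h.trans hi))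
    · exact h
    · have hj := σ.apply_symm_apply i
      rcases lt_trichotomy (σ.symm i) i with h' | h' | h'
      · have := ih _ h' (h'.trans hi)
        exact absurd (this.symm.trans hj) h'.ne
      · rwa [h'] at hj
      · have := hσ i _ hi h'
        rw [hj] at this
        exact absurd this h.asymm

theorem perm_eq_one_of_strictMono {n : ℕ} {σ : Equiv.Perm (Fin n)} (hσ : StrictMono σ) :
    σ = 1 := by
  ext i
  have := Subsingleton.elim (hσ.orderIsoOfSurjective σ σ.surjective) (OrderIso.refl _)
  exact congrArg Fin.val (DFunLike.congr_fun this i)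

theorem exists_eq_intervalRotation {n : ℕ} {σ : Equiv.Perm (Fin n)} (hav : avoids231 σ)
    (hdes : des σ = 1) : ∃ d m, ∃ h : d < m, σ = intervalRotation d m h := by
  rw [des, Nat.card_eq_one_iff_exists] at hdes
  obtain ⟨⟨d, hd, hlt⟩, huniq⟩ := hdes
  have hasc (t : Fin n) (htd : t ≠ d) (ht : (t : ℕ) + 1 < n) : σ t < σ ⟨(t : ℕ) + 1, ht⟩ := by
    by_contra hle
    have hne : σ ⟨(t : ℕ) + 1, ht⟩ ≠ σ t := fun h => by
      simpa [Fin.ext_iff] using σ.injective h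
    exact htd (congrArg Subtype.val (huniq ⟨t, ht, lt_of_le_of_ne (not_lt.1 hle) hne⟩))
  have hleft (i j : Fin n) (hij : i < j) (hj : j ≤ d) : σ i < σ j :=
    lt_of_forall_lt_succ hij fun t _ h2 => hasc t (h2.trans_le hj).ne
  have hright (i j : Fin n) (hi : d < i) (hij : i < j) : σ i < σ j :=
    lt_of_forall_lt_succ hij fun t h1 _ => hasc t (hi.trans_le h1).ne'
  have hlater (i j : Fin n) (hi : i < d) (hij : i < j) : σ i < σ j := by
    rcases le_or_gt j d with hj | hj
    · exact hleft i j hij hj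
    · refine lt_of_le_of_ne (not_lt.1 fun h => ?_) (σ.injective.ne hij.ne)
      exact hav ⟨i, d, j, hi, hj, h, hleft i d hi le_rfl⟩
  have hfix := apply_eq_self_of_lt_later hlater
  have hge (i : Fin n) (hi : d ≤ i) : d ≤ σ i := by
    by_contra! h
    exact absurd (σ.injective (hfix _ h)) (h.trans_le hi).ne
  have hdm : d < σ d :=
    (hge ⟨(d : ℕ) + 1, hd⟩ (Nat.le_succ _)).trans_lt hlt
  refine ⟨d, σ d, hdm, ?_⟩
  suffices σ.trans (intervalRotation d (σ d) hdm).symm = 1 by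
    ext i
    have := Equiv.congr_fun this i
    rw [Equiv.trans_apply, Equiv.symm_apply_eq] at this
    exact congrArg Fin.val this
  refine perm_eq_one_of_strictMono fun i j hij => ?_
  have hi := hfix i
  have hj := hfix j
  have hi' := hge i
  have hj' := hge j
  have hij' := hright i j
  have hne : d ≠ i → σ i ≠ σ d := fun h h' => h (σ.injective h').symm
  have hne' : d ≠ j → σ j ≠ σ d := fun h h' => h (σ.injective h').symm
  have hdi : d = i → σ d = σ i := congrArg σ
  simp only [Equiv.trans_apply, Fin.lt_def, Fin.le_def, ne_eq, Fin.ext_iff,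
    intervalRotation_symm_val] at *
  split_ifs <;> omega

theorem card_fin_pairs_lt (n : ℕ) :
    Nat.card {p : Fin n × Fin n // p.1 < p.2} = n.choose 2 := by
  let e : {p : Fin n × Fin n // p.1 < p.2} ≃ Σ m : Fin n, Fin m :=
    { toFun := fun p => ⟨p.1.2, ⟨p.1.1, p.2⟩⟩
      invFun := fun q => ⟨(⟨q.2, q.2.2.trans q.1.2⟩, q.1), q.2.2⟩
      left_inv := fun _ => rfl
      right_inv := fun _ => rfl }
  rw [Nat.card_congr e, Nat.card_eq_fintype_card, Fintype.card_sigma]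
  simp only [Fintype.card_fin]
  rw [Fin.sum_univ_eq_sum_range (fun i => i), Finset.sum_range_id, Nat.choose_two_right]

theorem a_one_descent (n k : ℕ) (hk : 1 ≤ k) (hn : 2 ≤ n) :
    a n 1 k = n.choose 2 := by
  rw [a, ← card_fin_pairs_lt]
  refine (Nat.card_eq_of_bijective (fun p => ⟨intervalRotation p.1.1 p.1.2 p.2,
    avoids231_intervalRotation p.2, des_intervalRotation p.2,
    (maxDrop_intervalRotation_le p.2).trans hk⟩) ⟨?_, ?_⟩).symm
  · rintro ⟨⟨d, m⟩, h⟩ ⟨⟨d', m'⟩, h'⟩ heq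
    obtain ⟨rfl, rfl⟩ := intervalRotation_injective h h' (congrArg Subtype.val heq)
    rfl
  · rintro ⟨σ, hav, hdes, _⟩
    obtain ⟨d, m, h, rfl⟩ := exists_eq_intervalRotation hav hdes
    exact ⟨⟨(d, m), h⟩, rfl⟩
end

section
/- For all k ≥ 2 and all n ≥ 3, the number of 231-avoiding permutations σ of {1,…,n} with des(σ) = 2 and md(σ) ≤ k equals (n−1)²((n−1)² − 1)/12. -/
namespace NatPerm

/-- `s` avoids the pattern 231. -/
def Avoids (s : Equiv.Perm ℕ) : Prop :=
  ∀ i j k, i < j → j < k → s k < s i → ¬ s i < s j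

/-- The descents of `s` are exactly `p < q`, with descent tops `u` and `v`. -/
def DescData (s : Equiv.Perm ℕ) (p q u v : ℕ) : Prop :=
  p < q ∧ (∀ x, s (x + 1) < s x ↔ x = p ∨ x = q) ∧ s p = u ∧ s q = v

theorem DescData.unique {s : Equiv.Perm ℕ} {p q u v p' q' u' v' : ℕ}
    (h : DescData s p q u v) (h' : DescData s p' q' u' v') :
    p = p' ∧ q = q' ∧ u = u' ∧ v = v' := by
  obtain ⟨h1, h2, rfl, rfl⟩ := h
  obtain ⟨h1', h2', rfl, rfl⟩ := h'
  have hp := (h2' p).1 ((h2 p).2 (Or.inl rfl))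
  have hq := (h2' q).1 ((h2 q).2 (Or.inr rfl))
  have hp' := (h2 p').1 ((h2' p').2 (Or.inl rfl))
  obtain rfl : p = p' := by omega
  obtain rfl : q = q' := by omega
  simp

/-- If all values below `e` occur before a non-descent `x` and `e` does not, then `s x = e`. -/
theorem Avoids.apply_eq {s : Equiv.Perm ℕ} (hs : Avoids s) {x e : ℕ}
    (hx : ¬ s (x + 1) < s x) (hlt : ∀ v < e, ∃ y < x, s y = v) (he : ∀ y < x, s y ≠ e) :
    s x = e := by
  rcases lt_trichotomy (s x) e with h | h | h
  · obtain ⟨y, hy, hyx⟩ := hlt _ h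
    exact absurd (s.injective hyx) (by omega)
  · exact h
  · exfalso
    obtain ⟨y, rfl⟩ := s.surjective e
    have h1 : ¬ y < x := fun hy => he y hy rfl
    have h2 : y ≠ x := by rintro rfl; omega
    have h3 : y ≠ x + 1 := by rintro rfl; omega
    have h4 : s x ≠ s (x + 1) := fun h => absurd (s.injective h) (by omega)
    exact hs x (x + 1) y (by omega) (by omega) h (by omega)

/-- At a descent, the top exceeds every `e` such that all values below `e` occurred before. -/
theorem lt_apply_of_descent {s : Equiv.Perm ℕ} {x e : ℕ}
    (hx : s (x + 1) < s x) (hlt : ∀ v < e, ∃ y < x, s y = v) : e < s x := by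
  by_contra! h
  obtain ⟨y, hy, hyx⟩ := hlt (s (x + 1)) (by omega)
  exact absurd (s.injective hyx) (by omega)

/-- A 231-avoiding permutation is determined by its descents and descent tops. -/
theorem Avoids.eq_of_descents {s t : Equiv.Perm ℕ} (hs : Avoids s) (ht : Avoids t)
    (hd : ∀ x, s (x + 1) < s x ↔ t (x + 1) < t x)
    (htop : ∀ x, s (x + 1) < s x → s x = t x) : s = t := by
  have key : ∀ {s t : Equiv.Perm ℕ}, Avoids t → ∀ {x}, (∀ y < x, s y = t y) →
      ¬ t (x + 1) < t x → ¬ s x < t x := by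
    intro s t ht x ih hx h
    obtain ⟨y, hy⟩ := t.surjective (s x)
    have h1 : ¬ y < x := fun hyx =>
      absurd (s.injective ((ih y hyx).trans hy)) (by omega)
    have h2 : y ≠ x := by rintro rfl; omega
    have h3 : y ≠ x + 1 := by rintro rfl; omega
    have h4 : t x ≠ t (x + 1) := fun h => absurd (t.injective h) (by omega)
    exact ht x (x + 1) y (by omega) (by omega) (by omega) (by omega)
  ext x
  induction x using Nat.strong_induction_on with
  | _ x ih =>
    by_cases hx : s (x + 1) < s x
    · exact htop x hx
    · have h1 := key ht ih (by rwa [← hd])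
      have h2 := key hs (fun y hy => (ih y hy).symm) hx
      omega

/-- The possible positions `p < q` and tops `u`, `v` of two descents in a 231-avoiding
permutation of `{0, …, n - 1}`. -/
def Admissible (n p q u v : ℕ) : Prop :=
  (p < u ∧ u < q ∧ q < v ∧ v < n) ∨ (p < q ∧ q ≤ v ∧ v < u ∧ u < n)

theorem Avoids.admissible {s : Equiv.Perm ℕ} (hs : Avoids s) {n p q u v : ℕ}
    (hfix : ∀ x, n ≤ x → s x = x) (h : DescData s p q u v) : Admissible n p q u v := by
  obtain ⟨hpq, hd, hu, hv⟩ := h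
  have hlt : ∀ x, s (x + 1) < s x → s x < n := by
    intro x hx
    by_contra! hn
    have := hfix x (by simpa using s.injective (hfix _ hn) ▸ hn)
    have := hfix (x + 1) (by omega)
    omega
  have hun := hlt p ((hd p).2 (Or.inl rfl))
  have hvn := hlt q ((hd q).2 (Or.inr rfl))
  have h1 : ∀ x < p, s x = x := by
    intro x
    induction x using Nat.strong_induction_on with
    | _ x ih =>
      intro hx
      refine hs.apply_eq (by rw [hd]; omega) (fun v hv => ⟨v, hv, ih v hv (by omega)⟩) ?_
      intro y hy
      rw [ih y hy (by omega)]
      omega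
  have hpu : p < u := hu ▸ lt_apply_of_descent ((hd p).2 (Or.inl rfl))
    fun v hv => ⟨v, hv, h1 v hv⟩
  have h2 : ∀ x, p < x → x < q → s x = if x ≤ u then x - 1 else x := by
    intro x
    induction x using Nat.strong_induction_on with
    | _ x ih =>
      intro hpx hx
      refine hs.apply_eq (by rw [hd]; omega) ?_ ?_
      · intro w hw
        by_cases hwp : w < p
        · exact ⟨w, by omega, h1 w hwp⟩
        by_cases hwu : w < u
        · refine ⟨w + 1, by split_ifs at hw <;> omega, ?_⟩
          rw [ih (w + 1) (by split_ifs at hw <;> omega) (by omega)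
            (by split_ifs at hw <;> omega), if_pos (by omega)]
          omega
        by_cases hwu' : w = u
        · exact ⟨p, hpx, by omega⟩
        · refine ⟨w, by split_ifs at hw <;> omega, ?_⟩
          rw [ih w (by split_ifs at hw <;> omega) (by omega)
            (by split_ifs at hw <;> omega), if_neg (by omega)]
      · intro y hy
        rcases lt_trichotomy y p with hyp | rfl | hyp
        · rw [h1 y hyp]; split_ifs <;> omega
        · split_ifs <;> omega
        · rw [ih y hy hyp (by omega)]; split_ifs <;> omega
  have hqd := (hd q).2 (Or.inr rfl)
  by_cases huq : u < q
  · refine Or.inl ⟨hpu, huq, ?_, by omega⟩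
    rw [← hv]
    refine lt_apply_of_descent hqd fun w hw => ?_
    by_cases hwp : w < p
    · exact ⟨w, by omega, h1 w hwp⟩
    by_cases hwu : w < u
    · exact ⟨w + 1, by omega, by rw [h2 _ (by omega) (by omega), if_pos (by omega)]; omega⟩
    by_cases hwu' : w = u
    · exact ⟨p, hpq, by omega⟩
    · exact ⟨w, by omega, by rw [h2 _ (by omega) (by omega), if_neg (by omega)]⟩
  · have hqv : q - 1 < s q := by
      refine lt_apply_of_descent hqd fun w hw => ?_
      by_cases hwp : w < p
      · exact ⟨w, by omega, h1 w hwp⟩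
      · exact ⟨w + 1, by omega, by rw [h2 _ (by omega) (by omega), if_pos (by omega)]; omega⟩
    have hne : s p ≠ s q := fun h => absurd (s.injective h) (by omega)
    refine Or.inr ⟨hpq, by omega, ?_, by omega⟩
    by_contra! hvu
    obtain ⟨y, hy⟩ := s.surjective (q - 1)
    refine hs p q y hpq ?_ (by omega) (by omega)
    by_contra! hyq
    rcases lt_trichotomy y p with hyp | rfl | hyp
    · have := h1 y hyp; omega
    · omega
    · by_cases hyq' : y = q
      · subst hyq'; omega
      · rw [h2 y hyp (by omega), if_pos (by omega)] at hy
        omega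

/-- The product of two disjoint consecutive cycles, moving `a` to `b` and `c` to `d`. -/
def separated (a b c d : ℕ) (hab : a < b) (hbc : b < c) (hcd : c < d) : Equiv.Perm ℕ where
  toFun x := if x < a then x else if x = a then b else if x ≤ b then x - 1 else
    if x < c then x else if x = c then d else if x ≤ d then x - 1 else x
  invFun x := if x < a then x else if x < b then x + 1 else if x = b then a else
    if x < c then x else if x < d then x + 1 else if x = d then c else x
  left_inv x := by dsimp only; grind
  right_inv x := by dsimp only; grind

/-- The 231-avoiding permutation with descents `a < b` and tops `d > c`. -/
def nested (a b c d : ℕ) (hab : a < b) (hbc : b ≤ c) (hcd : c < d) : Equiv.Perm ℕ where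
  toFun x := if x < a then x else if x = a then d else if x < b then x - 1 else
    if x = b then c else if x ≤ c + 1 then x - 2 else if x ≤ d then x - 1 else x
  invFun x := if x < a then x else if x + 1 < b then x + 1 else if x < c then x + 2 else
    if x = c then b else if x < d then x + 1 else if x = d then a else x
  left_inv x := by dsimp only; grind (splits := 20)
  right_inv x := by dsimp only; grind (splits := 20)

theorem exists_of_admissible {n p q u v : ℕ} (h : Admissible n p q u v) :
    ∃ s : Equiv.Perm ℕ, Avoids s ∧ DescData s p q u v ∧ (∀ x, n ≤ x → s x = x) ∧
      ∀ x, x ≤ s x + 2 := by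
  rcases h with ⟨h1, h2, h3, h4⟩ | ⟨h1, h2, h3, h4⟩
  · refine ⟨separated p u q v h1 h2 h3, ?_, ⟨by omega, ?_, ?_, ?_⟩, ?_, ?_⟩
    · intro i j k hij hjk
      simp only [separated, Equiv.coe_fn_mk]
      grind (splits := 40)
    all_goals simp only [separated, Equiv.coe_fn_mk]; grind (splits := 40)
  · refine ⟨nested p q v u h1 h2 h3, ?_, ⟨by omega, ?_, ?_, ?_⟩, ?_, ?_⟩
    · intro i j k hij hjk
      simp only [nested, Equiv.coe_fn_mk]
      grind (splits := 40)
    all_goals simp only [nested, Equiv.coe_fn_mk]; grind (splits := 40)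

/-- Quadruples `a < b < c < d < n`, listed from largest to smallest. -/
def chains (n : ℕ) : Finset (Σ _ : ℕ, Σ _ : ℕ, Σ _ : ℕ, ℕ) :=
  (Finset.range n).sigma fun d => (Finset.range d).sigma fun c =>
    (Finset.range c).sigma fun b => Finset.range b

theorem sum_range_choose_eq (n k : ℕ) :
    ∑ i ∈ Finset.range n, i.choose k = n.choose (k + 1) := by
  induction n with
  | zero => simp
  | succ n ih => rw [Finset.sum_range_succ, ih, Nat.choose_succ_succ, add_comm]

theorem card_chains (n : ℕ) : (chains n).card = n.choose 4 := by
  have h (c : ℕ) : ∑ b ∈ Finset.range c, b = c.choose 2 := by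
    simpa using sum_range_choose_eq c 1
  simp [chains, Finset.card_sigma, h, sum_range_choose_eq]

theorem card_admissible (n : ℕ) :
    Nat.card {t : ℕ × ℕ × ℕ × ℕ // Admissible n t.1 t.2.1 t.2.2.1 t.2.2.2} =
      n.choose 4 + (n + 1).choose 4 := by
  let f : (Σ _ : ℕ, Σ _ : ℕ, Σ _ : ℕ, ℕ) → ℕ × ℕ × ℕ × ℕ :=
    fun x => (x.2.2.2, x.2.1, x.2.2.1, x.1)
  let g : (Σ _ : ℕ, Σ _ : ℕ, Σ _ : ℕ, ℕ) → ℕ × ℕ × ℕ × ℕ :=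
    fun x => (x.2.2.2, x.2.2.1, x.1 - 1, x.2.1 - 1)
  have hf : Set.InjOn f (chains n) := by
    rintro ⟨d, c, b, a⟩ _ ⟨d', c', b', a'⟩ _ h
    simp only [f, Prod.mk.injEq] at h
    obtain ⟨rfl, rfl, rfl, rfl⟩ := h
    rfl
  have hg : Set.InjOn g (chains (n + 1)) := by
    rintro ⟨d, c, b, a⟩ hx ⟨d', c', b', a'⟩ hy h
    simp only [chains, Finset.mem_coe, Finset.mem_sigma, Finset.mem_range] at hx hy
    simp only [g, Prod.mk.injEq] at h
    obtain ⟨rfl, rfl, h1, h2⟩ := h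
    obtain rfl : d = d' := by omega
    obtain rfl : c = c' := by omega
    rfl
  have hdisj : Disjoint ((chains n).image f) ((chains (n + 1)).image g) := by
    rw [Finset.disjoint_left]
    intro t h1 h2
    obtain ⟨⟨d, c, b, a⟩, hx, rfl⟩ := Finset.mem_image.1 h1
    obtain ⟨⟨d', c', b', a'⟩, hy, h⟩ := Finset.mem_image.1 h2
    simp only [chains, Finset.mem_sigma, Finset.mem_range] at hx hy
    simp only [f, g, Prod.mk.injEq] at h
    omega
  rw [← card_chains, ← card_chains, ← Finset.card_image_of_injOn hf,
    ← Finset.card_image_of_injOn hg, ← Finset.card_union_of_disjoint hdisj]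
  refine Nat.subtype_card _ ?_
  rintro ⟨p, q, u, v⟩
  simp only [Finset.mem_union, Finset.mem_image, chains, Finset.mem_sigma, Finset.mem_range,
    Admissible]
  constructor
  · rintro (⟨⟨d, c, b, a⟩, hx, h⟩ | ⟨⟨d, c, b, a⟩, hx, h⟩)
    · simp only [f, Prod.mk.injEq] at h
      dsimp only at hx
      omega
    · simp only [g, Prod.mk.injEq] at h
      dsimp only at hx
      omega
  · rintro (h | h)
    · exact Or.inl ⟨⟨v, q, u, p⟩, by dsimp only; omega, rfl⟩
    · exact Or.inr ⟨⟨u + 1, v + 1, q, p⟩, by dsimp only; omega, rfl⟩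

/-- The extension of a permutation of `{0, …, n - 1}` to `ℕ` fixing all `x ≥ n`. -/
def extend {n : ℕ} (σ : Equiv.Perm (Fin n)) : Equiv.Perm ℕ :=
  σ.extendDomain Fin.equivSubtype

theorem extend_apply {n : ℕ} (σ : Equiv.Perm (Fin n)) (i : Fin n) :
    extend σ i = σ i :=
  σ.extendDomain_apply_image Fin.equivSubtype i

theorem extend_apply_of_le {n : ℕ} (σ : Equiv.Perm (Fin n)) {x : ℕ} (hx : n ≤ x) :
    extend σ x = x :=
  σ.extendDomain_apply_not_subtype Fin.equivSubtype (by omega)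

theorem extend_apply_lt {n : ℕ} (σ : Equiv.Perm (Fin n)) {x : ℕ} (hx : x < n) :
    extend σ x < n :=
  (extend_apply σ ⟨x, hx⟩).symm ▸ (σ ⟨x, hx⟩).2

theorem extend_injective {n : ℕ} : Function.Injective (extend (n := n)) := by
  intro σ τ h
  ext i
  rw [← extend_apply, h, extend_apply]

theorem exists_extend_eq {n : ℕ} {s : Equiv.Perm ℕ} (hs : ∀ x, n ≤ x → s x = x) :
    ∃ σ : Equiv.Perm (Fin n), extend σ = s := by
  have h1 (x : ℕ) (hx : x < n) : s x < n := by
    by_contra! h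
    exact absurd (s.injective (hs _ h)) (by omega)
  have h2 (x : ℕ) (hx : x < n) : s.symm x < n := by
    by_contra! h
    have := hs _ h
    rw [s.apply_symm_apply] at this
    omega
  let σ : Equiv.Perm (Fin n) :=
    { toFun := fun i => ⟨s i, h1 i i.2⟩
      invFun := fun i => ⟨s.symm i, h2 i i.2⟩
      left_inv := fun i => by simp
      right_inv := fun i => by simp }
  refine ⟨σ, Equiv.ext fun x => ?_⟩
  by_cases hx : x < n
  · exact extend_apply σ ⟨x, hx⟩
  · rw [extend_apply_of_le σ (by omega), hs x (by omega)]

theorem avoids_extend {n : ℕ} (σ : Equiv.Perm (Fin n)) :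
    Avoids (extend σ) ↔ avoids231 σ := by
  constructor
  · rintro h ⟨i, j, k, hij, hjk, hki, hlt⟩
    refine h i j k hij hjk ?_ ?_ <;> simpa only [extend_apply]
  · intro h i j k hij hjk hki hlt
    have hk : k < n := by
      by_contra! hk
      rw [extend_apply_of_le σ hk] at hki
      by_cases hi : i < n
      · have := extend_apply_lt σ hi
        omega
      · rw [extend_apply_of_le σ (by omega)] at hki
        omega
    refine h ⟨⟨i, by omega⟩, ⟨j, by omega⟩, ⟨k, hk⟩, hij, hjk, ?_, ?_⟩ <;>
      simpa only [Fin.lt_def, ← extend_apply]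

theorem des_eq_ncard {n : ℕ} (σ : Equiv.Perm (Fin n)) :
    des σ = {x : ℕ | extend σ (x + 1) < extend σ x}.ncard := by
  have hlt (x : ℕ) (hx : extend σ (x + 1) < extend σ x) : x + 1 < n := by
    by_contra! h
    rw [extend_apply_of_le σ h] at hx
    by_cases h' : x < n
    · have := extend_apply_lt σ h'
      omega
    · rw [extend_apply_of_le σ (by omega)] at hx
      omega
  refine Nat.card_congr
    { toFun := fun i => ⟨i.1, ?_⟩
      invFun := fun x => ⟨⟨x.1, by have := hlt x.1 x.2; omega⟩, hlt x.1 x.2, ?_⟩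
      left_inv := fun i => rfl
      right_inv := fun x => rfl }
  · obtain ⟨h, hi⟩ := i.2
    simpa only [Set.mem_ofPred_eq, Fin.lt_def, ← extend_apply] using hi
  · simpa only [Set.mem_ofPred_eq, Fin.lt_def, ← extend_apply] using x.2

theorem des_eq_two_iff {n : ℕ} (σ : Equiv.Perm (Fin n)) :
    des σ = 2 ↔ ∃ p q u v, DescData (extend σ) p q u v := by
  rw [des_eq_ncard, Set.ncard_eq_two]
  constructor
  · rintro ⟨p, q, hpq, h⟩
    have hd (x : ℕ) : extend σ (x + 1) < extend σ x ↔ x = p ∨ x = q := by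
      simpa using Set.ext_iff.1 h x
    rcases lt_or_gt_of_ne hpq with hlt | hlt
    · exact ⟨p, q, _, _, hlt, hd, rfl, rfl⟩
    · exact ⟨q, p, _, _, hlt, fun x => (hd x).trans or_comm, rfl, rfl⟩
  · rintro ⟨p, q, _, _, hpq, hd, _, _⟩
    exact ⟨p, q, hpq.ne, Set.ext hd⟩

theorem Avoids.eq_of_descData {s t : Equiv.Perm ℕ} (hs : Avoids s) (ht : Avoids t)
    {p q u v : ℕ} (h : DescData s p q u v) (h' : DescData t p q u v) : s = t := by
  obtain ⟨-, hd, hu, hv⟩ := h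
  obtain ⟨-, hd', hu', hv'⟩ := h'
  refine hs.eq_of_descents ht (fun x => (hd x).trans (hd' x).symm) fun x hx => ?_
  rcases (hd x).1 hx with rfl | rfl
  · rw [hu, hu']
  · rw [hv, hv']

theorem maxDrop_le_iff {n k : ℕ} (σ : Equiv.Perm (Fin n)) :
    maxDrop σ ≤ k ↔ ∀ i : Fin n, (i : ℕ) ≤ σ i + k := by
  simp [maxDrop, add_comm]

theorem a_two_eq (n k : ℕ) (hk : 2 ≤ k) : a n 2 k = n.choose 4 + (n + 1).choose 4 := by
  rw [← card_admissible]
  have hex (σ : {σ : Equiv.Perm (Fin n) // avoids231 σ ∧ des σ = 2 ∧ maxDrop σ ≤ k}) :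
      ∃ t : {t : ℕ × ℕ × ℕ × ℕ // Admissible n t.1 t.2.1 t.2.2.1 t.2.2.2},
        DescData (extend σ.1) t.1.1 t.1.2.1 t.1.2.2.1 t.1.2.2.2 := by
    obtain ⟨p, q, u, v, h⟩ := (des_eq_two_iff σ.1).1 σ.2.2.1
    exact ⟨⟨(p, q, u, v), ((avoids_extend σ.1).2 σ.2.1).admissible
      (fun x => extend_apply_of_le σ.1) h⟩, h⟩
  choose f hf using hex
  refine Nat.card_eq_of_bijective f ⟨fun σ τ h => ?_, fun t => ?_⟩
  · have hτ := hf τ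
    rw [← h] at hτ
    exact Subtype.ext (extend_injective (((avoids_extend σ.1).2 σ.2.1).eq_of_descData
      ((avoids_extend τ.1).2 τ.2.1) (hf σ) hτ))
  · obtain ⟨s, hs, hd, hfix, hdrop⟩ := exists_of_admissible t.2
    obtain ⟨σ, rfl⟩ := exists_extend_eq hfix
    have hmem : avoids231 σ ∧ des σ = 2 ∧ maxDrop σ ≤ k := by
      refine ⟨(avoids_extend σ).1 hs, (des_eq_two_iff σ).2 ⟨_, _, _, _, hd⟩,
        (maxDrop_le_iff σ).2 fun i => ?_⟩
      have := hdrop i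
      rw [extend_apply] at this
      omega
    obtain ⟨h1, h2, h3, h4⟩ := (hf ⟨σ, hmem⟩).unique hd
    exact ⟨⟨σ, hmem⟩, Subtype.ext (Prod.ext h1 (Prod.ext h2 (Prod.ext h3 h4)))⟩

theorem twelve_mul_choose_add_choose (m : ℕ) :
    12 * ((m + 3).choose 4 + (m + 4).choose 4) = (m + 2) ^ 2 * ((m + 2) ^ 2 - 1) := by
  have h1 := Nat.descFactorial_eq_factorial_mul_choose (m + 3) 4
  have h2 := Nat.descFactorial_eq_factorial_mul_choose (m + 4) 4
  simp [Nat.descFactorial, Nat.factorial] at h1 h2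
  have h3 : (m + 2) ^ 2 - 1 = (m + 1) * (m + 3) := by
    rw [Nat.sub_eq_iff_eq_add (Nat.one_le_pow _ _ (by omega))]
    ring
  rw [h3]
  nlinarith

end NatPerm

theorem a_two_descents (n k : ℕ) (hk : 2 ≤ k) (hn : 3 ≤ n) :
    12 * a n 2 k = (n - 1) ^ 2 * ((n - 1) ^ 2 - 1) := by
  obtain ⟨m, rfl⟩ := Nat.exists_eq_add_of_le' hn
  rw [NatPerm.a_two_eq _ k hk]
  exact NatPerm.twelve_mul_choose_add_choose m
end

section
/- For all n ≥ 3, the number of 231-avoiding permutations σ of {1,…,n} with des(σ) = 2 and md(σ) = 2 (maximum drop exactly 2) equals the binomial coefficient C(n+1, 4). -/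
/-- The one-line notation, on `{0, …, n - 1}`, of the permutation with descents exactly at the
positions `p < q` that takes the values `d - 1` at `p` and `c - 1` at `q`, and increases on all
other positions. -/
def twoDescentFun (p q c d i : ℕ) : ℕ :=
  if i < p then i else if i = p then d - 1 else if i < q then i - 1
  else if i = q then c - 1 else if i ≤ c then i - 2 else if i < d then i - 1 else i

section TwoDescentFun

variable {n p q c d : ℕ}

theorem twoDescentFun_lt (hqc : q < c) (hcd : c < d) (hdn : d ≤ n) {i : ℕ}
    (hi : i < n) : twoDescentFun p q c d i < n := by
  unfold twoDescentFun
  split_ifs <;> omega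

theorem twoDescentFun_inj (hpq : p < q) (hqc : q < c) (hcd : c < d) {i j : ℕ}
    (h : twoDescentFun p q c d i = twoDescentFun p q c d j) : i = j := by
  unfold twoDescentFun at h
  split_ifs at h <;> omega

theorem twoDescentFun_succ_lt_iff (hpq : p < q) (hqc : q < c) (hcd : c < d) {i : ℕ} :
    twoDescentFun p q c d (i + 1) < twoDescentFun p q c d i ↔ i = p ∨ i = q := by
  unfold twoDescentFun
  split_ifs <;> omega

theorem twoDescentFun_left : twoDescentFun p q c d p = d - 1 := by
  simp [twoDescentFun]

theorem twoDescentFun_right (hpq : p < q) : twoDescentFun p q c d q = c - 1 := by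
  unfold twoDescentFun
  split_ifs <;> omega

theorem twoDescentFun_lt_of_lt (hpq : p < q) (hqc : q < c) (hcd : c < d) {i j : ℕ} (hij : i < j)
    (hip : i ≠ p) (hiq : i ≠ q) : twoDescentFun p q c d i < twoDescentFun p q c d j := by
  unfold twoDescentFun
  split_ifs <;> omega

theorem twoDescentFun_avoids (hpq : p < q) (hqc : q < c) (hcd : c < d) {i j k : ℕ}
    (hij : i < j) (hjk : j < k) (hki : twoDescentFun p q c d k < twoDescentFun p q c d i) :
    twoDescentFun p q c d j < twoDescentFun p q c d i := by
  by_cases hip : i = p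
  · subst hip
    rw [twoDescentFun_left] at *
    unfold twoDescentFun at *
    split_ifs at * <;> omega
  by_cases hiq : i = q
  · subst hiq
    rw [twoDescentFun_right hpq] at *
    unfold twoDescentFun at *
    split_ifs at * <;> omega
  exact absurd hki (twoDescentFun_lt_of_lt hpq hqc hcd (hij.trans hjk) hip hiq).asymm

/-- `twoDescentFun` as a permutation of `Fin n`. -/
noncomputable def twoDescentPerm (hpq : p < q) (hqc : q < c) (hcd : c < d) (hdn : d ≤ n) :
    Equiv.Perm (Fin n) :=
  Equiv.ofBijective
    (fun i => ⟨twoDescentFun p q c d i, twoDescentFun_lt hqc hcd hdn i.isLt⟩)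
    (Finite.injective_iff_bijective.mp fun _ _ h =>
      Fin.ext (twoDescentFun_inj hpq hqc hcd (Fin.mk.inj h)))

theorem twoDescentPerm_val (hpq : p < q) (hqc : q < c) (hcd : c < d) (hdn : d ≤ n) (i : Fin n) :
    (twoDescentPerm hpq hqc hcd hdn i : ℕ) = twoDescentFun p q c d i := rfl

theorem avoids231_twoDescentPerm (hpq : p < q) (hqc : q < c) (hcd : c < d) (hdn : d ≤ n) :
    avoids231 (twoDescentPerm hpq hqc hcd hdn) := by
  rintro ⟨i, j, k, hij, hjk, hki, h⟩
  exact (twoDescentFun_avoids hpq hqc hcd hij hjk hki).asymm h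

theorem maxDrop_twoDescentPerm (hpq : p < q) (hqc : q < c) (hcd : c < d) (hdn : d ≤ n) :
    maxDrop (twoDescentPerm hpq hqc hcd hdn) = 2 := by
  apply le_antisymm
  · refine Finset.sup_le fun i _ => ?_
    rw [twoDescentPerm_val]
    unfold twoDescentFun
    split_ifs <;> omega
  · refine le_trans ?_ (Finset.le_sup (Finset.mem_univ (⟨c, by omega⟩ : Fin n)))
    rw [twoDescentPerm_val]
    unfold twoDescentFun
    split_ifs <;> dsimp only at * <;> omega

end TwoDescentFun

section Descents

variable {n : ℕ} {σ : Equiv.Perm (Fin n)}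

/-- `i` is a descent of `σ`. -/
def IsDescent (σ : Equiv.Perm (Fin n)) (i : Fin n) : Prop :=
  ∃ h : (i : ℕ) + 1 < n, σ ⟨(i : ℕ) + 1, h⟩ < σ i

theorem des_eq_two_iff :
    des σ = 2 ↔ ∃ p q : Fin n, p < q ∧ ∀ i, IsDescent σ i ↔ i = p ∨ i = q := by
  have key : des σ = {i | IsDescent σ i}.ncard := rfl
  rw [key, Set.ncard_eq_two]
  constructor
  · rintro ⟨p, q, hne, h⟩
    have h' : ∀ i, IsDescent σ i ↔ i = p ∨ i = q := fun i => Set.ext_iff.mp h i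
    rcases lt_or_gt_of_ne hne with hlt | hlt
    · exact ⟨p, q, hlt, h'⟩
    · exact ⟨q, p, hlt, fun i => (h' i).trans or_comm⟩
  · rintro ⟨p, q, hlt, h⟩
    exact ⟨p, q, hlt.ne, Set.ext h⟩

theorem isDescent_twoDescentPerm_iff {p q c d : ℕ} (hpq : p < q) (hqc : q < c) (hcd : c < d)
    (hdn : d ≤ n) (i : Fin n) :
    IsDescent (twoDescentPerm hpq hqc hcd hdn) i ↔ (i : ℕ) = p ∨ (i : ℕ) = q := by
  rw [← twoDescentFun_succ_lt_iff hpq hqc hcd]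
  refine ⟨fun ⟨_, h⟩ => h, fun h => ⟨?_, h⟩⟩
  rcases (twoDescentFun_succ_lt_iff hpq hqc hcd).mp h with h | h <;> omega

theorem des_twoDescentPerm {p q c d : ℕ} (hpq : p < q) (hqc : q < c) (hcd : c < d)
    (hdn : d ≤ n) : des (twoDescentPerm hpq hqc hcd hdn) = 2 := by
  refine des_eq_two_iff.mpr ⟨⟨p, by omega⟩, ⟨q, by omega⟩, hpq, fun i => ?_⟩
  simp [isDescent_twoDescentPerm_iff, Fin.ext_iff]

theorem lt_of_forall_not_isDescent {i j : Fin n} (hij : i < j)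
    (h : ∀ k, i ≤ k → k < j → ¬ IsDescent σ k) : σ i < σ j := by
  obtain ⟨i, hi⟩ := i
  obtain ⟨j, hj⟩ := j
  have hij' : i + 1 ≤ j := hij
  clear hij
  induction j, hij' using Nat.le_induction with
  | base =>
    have h₁ : ¬ σ ⟨i + 1, hj⟩ < σ ⟨i, hi⟩ := fun hlt =>
      h ⟨i, hi⟩ le_rfl (Fin.mk_lt_mk.mpr i.lt_succ_self) ⟨hj, hlt⟩
    refine lt_of_le_of_ne (not_lt.mp h₁) fun he => ?_
    simpa using σ.injective he
  | succ j hij ih =>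
    have hj' : j < n := by omega
    have h₀ := ih hj' fun k hik hkj => h k hik (hkj.trans (Fin.mk_lt_mk.mpr j.lt_succ_self))
    have h₁ : ¬ σ ⟨j + 1, hj⟩ < σ ⟨j, hj'⟩ := fun hlt =>
      h ⟨j, hj'⟩ (Fin.mk_le_mk.mpr (by omega)) (Fin.mk_lt_mk.mpr j.lt_succ_self) ⟨hj, hlt⟩
    exact h₀.trans_le (not_lt.mp h₁)

theorem card_le_of_forall_lt {i : Fin n} (s : Finset (Fin n)) (h : ∀ j ∈ s, σ j < σ i) :
    s.card ≤ σ i := by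
  rw [← Fin.card_Iio (σ i)]
  exact Finset.card_le_card_of_injOn σ
    (fun j hj => Finset.mem_coe.mpr (Finset.mem_Iio.mpr (h j hj))) σ.injective.injOn

theorem le_add_one_of_forall_lt {i r : Fin n} (h : ∀ j, j < i → j ≠ r → σ j < σ i) :
    (i : ℕ) ≤ σ i + 1 := by
  have h₁ := card_le_of_forall_lt (σ := σ) (i := i) ((Finset.Iio i).erase r) fun j hj =>
    h j (Finset.mem_Iio.mp (Finset.mem_of_mem_erase hj)) (Finset.ne_of_mem_erase hj)
  have h₂ := Finset.pred_card_le_card_erase (s := Finset.Iio i) (a := r)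
  rw [Fin.card_Iio] at h₂
  omega

theorem eq_of_eqOn_of_strictMonoOn_compl {τ : Equiv.Perm (Fin n)} {s : Set (Fin n)}
    (hs : ∀ i ∈ s, σ i = τ i) (hσ : StrictMonoOn σ sᶜ) (hτ : StrictMonoOn τ sᶜ) : σ = τ := by
  have key : ∀ (σ τ : Equiv.Perm (Fin n)), (∀ i ∈ s, σ i = τ i) → StrictMonoOn τ sᶜ →
      ∀ i, (∀ j < i, σ j = τ j) → ¬ σ i < τ i := by
    intro σ τ hs hτ i ih hlt
    obtain ⟨j, hj⟩ := τ.surjective (σ i)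
    rcases lt_trichotomy j i with hji | rfl | hji
    · exact hji.ne (σ.injective ((ih j hji).trans hj))
    · exact hlt.ne hj.symm
    · have hjs : j ∉ s := fun hmem => hji.ne' (σ.injective ((hs j hmem).trans hj))
      have his : i ∉ s := fun hmem => hlt.ne (hs i hmem)
      exact (hτ his hjs hji).asymm (hj ▸ hlt)
  ext1 i
  induction i using WellFoundedLT.induction with
  | ind i ih =>
    exact le_antisymm
      (not_lt.mp (key τ σ (fun i hi => (hs i hi).symm) hσ i fun j hj => (ih j hj).symm))
      (not_lt.mp (key σ τ hs hτ i ih))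

end Descents

theorem strictMonoOn_twoDescentPerm {n p q c d : ℕ} (hpq : p < q) (hqc : q < c) (hcd : c < d)
    (hdn : d ≤ n) {s : Set (Fin n)} (hs : ∀ i ∉ s, (i : ℕ) ≠ p ∧ (i : ℕ) ≠ q) :
    StrictMonoOn (twoDescentPerm hpq hqc hcd hdn) sᶜ := fun i hi _ _ hij =>
  twoDescentFun_lt_of_lt hpq hqc hcd hij (hs i hi).1 (hs i hi).2

theorem exists_eq_twoDescentPerm {n : ℕ} {σ : Equiv.Perm (Fin n)} (hav : avoids231 σ)
    (hdes : des σ = 2) (hmd : maxDrop σ = 2) :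
    ∃ (p q c d : ℕ) (hpq : p < q) (hqc : q < c) (hcd : c < d) (hdn : d ≤ n),
      twoDescentPerm hpq hqc hcd hdn = σ := by
  obtain ⟨p, q, hpq, hD⟩ := des_eq_two_iff.mp hdes
  have mono : ∀ i j : Fin n, i < j → (∀ k, i ≤ k → k < j → k ≠ p ∧ k ≠ q) → σ i < σ j :=
    fun i j hij h => lt_of_forall_not_isDescent hij fun k hik hkj hk =>
      ((hD k).mp hk).elim (h k hik hkj).1 (h k hik hkj).2
  have avoid : ∀ i j k : Fin n, i < j → j < k → σ i < σ j → σ i < σ k := by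
    intro i j k hij hjk hlt
    by_contra hik
    exact hav ⟨i, j, k, hij, hjk, lt_of_le_of_ne (not_lt.mp hik)
      fun he => (hij.trans hjk).ne' (σ.injective he), hlt⟩
  have before_p : ∀ i j : Fin n, i < p → i < j → σ i < σ j := by
    intro i j hi hij
    have hip := mono i p hi fun k _ hk => ⟨hk.ne, (hk.trans hpq).ne⟩
    rcases lt_trichotomy j p with hj | rfl | hj
    · exact mono i j hij fun k _ hk => ⟨(hk.trans hj).ne, (hk.trans (hj.trans hpq)).ne⟩
    · exact hip
    · exact avoid i p j hi hj hip
  have before_q : ∀ i j : Fin n, p < i → i < q → i < j → σ i < σ j := by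
    intro i j hpi hiq hij
    have hq := mono i q hiq fun k hk hkq => ⟨(hpi.trans_le hk).ne', hkq.ne⟩
    rcases lt_trichotomy j q with hj | rfl | hj
    · exact mono i j hij fun k hk hkj => ⟨(hpi.trans_le hk).ne', (hkj.trans hj).ne⟩
    · exact hq
    · exact avoid i q j hiq hj hq
  have off : ∀ i j : Fin n, i ≠ p → i ≠ q → i < j → σ i < σ j := by
    intro i j hip hiq hij
    rcases lt_or_gt_of_ne hip with h | h
    · exact before_p i j h hij
    · rcases lt_or_gt_of_ne hiq with h' | h'
      · exact before_q i j h h' hij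
      · exact mono i j hij fun k hk _ => ⟨(h.trans_le hk).ne', (h'.trans_le hk).ne'⟩
  have hqp : σ q < σ p := by
    by_contra hnot
    have hlt : σ p < σ q := lt_of_le_of_ne (not_lt.mp hnot) fun he => hpq.ne (σ.injective he)
    have hdrop : ∀ i : Fin n, (i : ℕ) ≤ σ i + 1 := by
      intro i
      rcases le_or_gt i q with hiq | hqi
      · exact le_add_one_of_forall_lt (r := p) fun j hji hjp =>
          off j i hjp (hji.trans_le hiq).ne hji
      · refine le_add_one_of_forall_lt (r := q) fun j hji hjq => ?_
        by_cases hjp : j = p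
        · exact hjp ▸ avoid p q i hpq hqi hlt
        · exact off j i hjp hjq hji
    have : maxDrop σ ≤ 1 := Finset.sup_le fun i _ => Nat.sub_le_iff_le_add'.mpr (hdrop i)
    omega
  obtain ⟨hq, hlt⟩ := (hD q).mpr (Or.inr rfl)
  have hle : (q : ℕ) ≤ σ q := by
    have h := card_le_of_forall_lt (σ := σ) (i := q)
      (((Finset.Iic ⟨(q : ℕ) + 1, hq⟩).erase p).erase q) ?_
    · have h₁ : p ∈ Finset.Iic (⟨(q : ℕ) + 1, hq⟩ : Fin n) :=
        Finset.mem_Iic.mpr (Fin.mk_le_mk.mpr (by omega))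
      have h₂ : q ∈ (Finset.Iic (⟨(q : ℕ) + 1, hq⟩ : Fin n)).erase p :=
        Finset.mem_erase.mpr ⟨hpq.ne', Finset.mem_Iic.mpr (Fin.mk_le_mk.mpr (by omega))⟩
      rw [Finset.card_erase_of_mem h₂, Finset.card_erase_of_mem h₁, Fin.card_Iic] at h
      exact h
    · intro j hj
      simp only [Finset.mem_erase, Finset.mem_Iic] at hj
      obtain ⟨hjq, hjp, hj⟩ := hj
      rcases lt_or_gt_of_ne hjq with h | h
      · exact off j q hjp hjq h
      · have : j = ⟨(q : ℕ) + 1, hq⟩ := le_antisymm hj h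
        rwa [this]
  refine ⟨p, q, σ q + 1, σ p + 1, hpq, by omega, by omega, (σ p).isLt, ?_⟩
  refine eq_of_eqOn_of_strictMonoOn_compl (s := {p, q}) ?_ ?_ ?_
  · rintro i (rfl | rfl) <;> apply Fin.ext <;> rw [twoDescentPerm_val]
    · exact twoDescentFun_left
    · exact twoDescentFun_right hpq
  · refine strictMonoOn_twoDescentPerm _ _ _ _ fun i hi => ?_
    simpa [Fin.ext_iff] using hi
  · intro i hi j _ hij
    simp only [Set.mem_compl_iff, Set.mem_insert_iff, Set.mem_singleton_iff, not_or] at hi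
    exact off i j hi.1 hi.2 hij

theorem twoDescentPerm_inj {n p q c d p' q' c' d' : ℕ} (hpq : p < q) (hqc : q < c) (hcd : c < d)
    (hdn : d ≤ n) (hpq' : p' < q') (hqc' : q' < c') (hcd' : c' < d') (hdn' : d' ≤ n)
    (h : twoDescentPerm hpq hqc hcd hdn = twoDescentPerm hpq' hqc' hcd' hdn') :
    p = p' ∧ q = q' ∧ c = c' ∧ d = d' := by
  have hD : ∀ i : Fin n, ((i : ℕ) = p ∨ (i : ℕ) = q) ↔ ((i : ℕ) = p' ∨ (i : ℕ) = q') := fun i => by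
    rw [← isDescent_twoDescentPerm_iff hpq hqc hcd hdn, h, isDescent_twoDescentPerm_iff]
  have h₁ := hD ⟨p, by omega⟩
  have h₂ := hD ⟨q, by omega⟩
  have h₃ := hD ⟨p', by omega⟩
  have h₄ := hD ⟨q', by omega⟩
  dsimp only at h₁ h₂ h₃ h₄
  obtain rfl : p = p' := by omega
  obtain rfl : q = q' := by omega
  have h₅ : twoDescentFun p q c d p = twoDescentFun p q c' d' p :=
    congrArg (fun τ : Equiv.Perm (Fin n) => (τ ⟨p, by omega⟩ : ℕ)) h
  have h₆ : twoDescentFun p q c d q = twoDescentFun p q c' d' q :=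
    congrArg (fun τ : Equiv.Perm (Fin n) => (τ ⟨q, by omega⟩ : ℕ)) h
  rw [twoDescentFun_left, twoDescentFun_left] at h₅
  rw [twoDescentFun_right hpq, twoDescentFun_right hpq] at h₆
  omega

theorem card_des_two_maxDrop_two (n : ℕ) (hn : 3 ≤ n) :
    Nat.card {σ : Equiv.Perm (Fin n) // avoids231 σ ∧ des σ = 2 ∧ maxDrop σ = 2} =
      (n + 1).choose 4 := by
  have h01 (f : Fin 4 ↪o Fin (n + 1)) : (f 0 : ℕ) < f 1 := f.strictMono (by decide)
  have h12 (f : Fin 4 ↪o Fin (n + 1)) : (f 1 : ℕ) < f 2 := f.strictMono (by decide)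
  have h23 (f : Fin 4 ↪o Fin (n + 1)) : (f 2 : ℕ) < f 3 := f.strictMono (by decide)
  have h3 (f : Fin 4 ↪o Fin (n + 1)) : (f 3 : ℕ) ≤ n := Nat.le_of_lt_succ (f 3).isLt
  let Φ (f : Fin 4 ↪o Fin (n + 1)) :
      {σ : Equiv.Perm (Fin n) // avoids231 σ ∧ des σ = 2 ∧ maxDrop σ = 2} :=
    ⟨twoDescentPerm (h01 f) (h12 f) (h23 f) (h3 f), avoids231_twoDescentPerm _ _ _ _,
      des_twoDescentPerm _ _ _ _, maxDrop_twoDescentPerm _ _ _ _⟩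
  have hΦ : Function.Bijective Φ := by
    constructor
    · intro f g hfg
      obtain ⟨e0, e1, e2, e3⟩ := twoDescentPerm_inj (h01 f) (h12 f) (h23 f) (h3 f)
        (h01 g) (h12 g) (h23 g) (h3 g) (congrArg Subtype.val hfg)
      ext i
      fin_cases i <;> assumption
    · rintro ⟨σ, hav, hdes, hmd⟩
      obtain ⟨p, q, c, d, hpq, hqc, hcd, hdn, rfl⟩ := exists_eq_twoDescentPerm hav hdes hmd
      refine ⟨OrderEmbedding.ofStrictMono
        ![⟨p, by omega⟩, ⟨q, by omega⟩, ⟨c, by omega⟩, ⟨d, by omega⟩] ?_, rfl⟩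
      rw [Fin.strictMono_iff_lt_succ]
      intro i
      fin_cases i <;> simpa
  rw [← Nat.card_congr (Equiv.ofBijective Φ hΦ), Nat.card_congr Set.powersetCard.ofFinEmbEquiv,
    Set.powersetCard.card, Nat.card_fin]
end

section
/- For all n ≥ 1 and all j, k ≥ 0, the number of 231-avoiding permutations σ of {1,…,n} with des(σ) = j and md(σ) ≤ k equals the number of Dyck paths of length 2n with exactly n − j peaks and height at most k + 1. -/
/-- `s` encodes a Dyck path of length `2n`: steps `s 0, …, s (2n-1)` are `±1`,
all partial sums are nonnegative, the total sum is `0`, and `s` is `0` beyond `2n`. -/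
def IsDyckPath (n : ℕ) (s : ℕ → ℤ) : Prop :=
  (∀ i < 2 * n, s i = 1 ∨ s i = -1) ∧ (∀ i, 2 * n ≤ i → s i = 0) ∧
    (∀ m ≤ 2 * n, 0 ≤ ∑ i ∈ Finset.range m, s i) ∧ ∑ i ∈ Finset.range (2 * n), s i = 0

/-- The number of peaks of a Dyck path: positions where an up-step is
immediately followed by a down-step. -/
noncomputable def numPeaks (n : ℕ) (s : ℕ → ℤ) : ℕ :=
  Nat.card {i : ℕ // i + 1 < 2 * n ∧ s i = 1 ∧ s (i + 1) = -1}

/-- The height of a Dyck path: the maximum partial sum. -/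
def pathHeight (n : ℕ) (s : ℕ → ℤ) : ℕ :=
  (Finset.range (2 * n + 1)).sup fun m => (∑ i ∈ Finset.range m, s i).toNat

/-- The number of Dyck paths of length `2n` with exactly `j` peaks and height at most `k`. -/
noncomputable def dyckCount (n j k : ℕ) : ℕ :=
  Nat.card {s : ℕ → ℤ // IsDyckPath n s ∧ numPeaks n s = j ∧ pathHeight n s ≤ k}

/-- The number of nodes of a binary tree whose right subtree is nonempty. -/
def numRightFull : BinaryTree Unit → ℕ
  | .nil => 0
  | .node _ l r => numRightFull l + numRightFull r + if r.numNodes = 0 then 0 else 1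

/-- The number of nodes of a binary tree whose right subtree is empty. -/
def numRightEmpty : BinaryTree Unit → ℕ
  | .nil => 0
  | .node _ l r => numRightEmpty l + numRightEmpty r + if r.numNodes = 0 then 1 else 0

/-- One more than the largest number of right edges on a path from the root of a binary tree to
a node, and `0` for the empty tree. -/
def rightDepth : BinaryTree Unit → ℕ
  | .nil => 0
  | .node _ l r => max (rightDepth l) (rightDepth r + 1)

theorem numRightFull_add_numRightEmpty (t : BinaryTree Unit) :
    numRightFull t + numRightEmpty t = t.numNodes := by
  induction t with
  | nil => rfl
  | node _ l r hl hr => simp only [numRightFull, numRightEmpty, BinaryTree.numNodes]; grind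

theorem numRightEmpty_pos (t : BinaryTree Unit) (ht : 0 < t.numNodes) :
    0 < numRightEmpty t := by
  induction t with
  | nil => simp at ht
  | node _ l r hl hr => simp only [numRightEmpty]; grind

theorem rightDepth_eq_zero (t : BinaryTree Unit) (ht : t.numNodes = 0) : rightDepth t = 0 := by
  cases t with
  | nil => rfl
  | node _ l r => simp at ht

/-! ### Dyck paths -/

/-- `H` is the sequence of heights of a Dyck path of length `2n`, extended by zero. -/
structure IsDyckHeight (n : ℕ) (H : ℕ → ℕ) : Prop where
  zero : H 0 = 0
  step : ∀ i < 2 * n, H (i + 1) = H i + 1 ∨ H i = H (i + 1) + 1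
  beyond : ∀ i, 2 * n ≤ i → H i = 0

/-- The heights of the Dyck path of a binary tree, where a node stands for the concatenation of
the path of its left subtree with the elevated path of its right subtree. -/
def dyckHeight : BinaryTree Unit → ℕ → ℕ
  | .nil, _ => 0
  | .node _ l r, m =>
    if m ≤ 2 * l.numNodes then dyckHeight l m
    else if m ≤ 2 * l.numNodes + 1 + 2 * r.numNodes then
      dyckHeight r (m - 2 * l.numNodes - 1) + 1
    else 0

section node

variable {u : Unit} {l r : BinaryTree Unit} {m : ℕ}

theorem dyckHeight_node_left (hm : m ≤ 2 * l.numNodes) :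
    dyckHeight (.node u l r) m = dyckHeight l m := by
  simp [dyckHeight, hm]

theorem dyckHeight_node_right (hm : m ≤ 2 * r.numNodes) :
    dyckHeight (.node u l r) (2 * l.numNodes + 1 + m) = dyckHeight r m + 1 := by
  have e : 2 * l.numNodes + 1 + m - 2 * l.numNodes - 1 = m := by omega
  rw [dyckHeight, if_neg (by omega), if_pos (by omega), e]

theorem dyckHeight_node_of_lt (hm : 2 * l.numNodes + 1 + 2 * r.numNodes < m) :
    dyckHeight (.node u l r) m = 0 := by
  rw [dyckHeight, if_neg (by omega), if_neg (by omega)]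

end node

theorem isDyckHeight_dyckHeight (t : BinaryTree Unit) :
    IsDyckHeight t.numNodes (dyckHeight t) := by
  induction t with
  | nil => exact ⟨rfl, by simp, fun _ _ => rfl⟩
  | node v l r hl hr =>
    refine ⟨?_, fun i hi => ?_, fun i hi => dyckHeight_node_of_lt ?_⟩
    · rw [dyckHeight_node_left (Nat.zero_le _), hl.zero]
    · simp only [BinaryTree.numNodes] at hi
      rcases lt_trichotomy i (2 * l.numNodes) with h | rfl | h
      · rw [dyckHeight_node_left h, dyckHeight_node_left h.le]
        exact hl.step i h
      · left
        rw [dyckHeight_node_left le_rfl, hl.beyond _ le_rfl,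
          ← add_zero (2 * l.numNodes + 1), dyckHeight_node_right (Nat.zero_le _), hr.zero]
      · obtain ⟨i, rfl⟩ := Nat.exists_eq_add_of_le (Nat.succ_le_of_lt h)
        rw [Nat.succ_eq_add_one, dyckHeight_node_right (by omega)]
        rcases lt_or_ge i (2 * r.numNodes) with h' | h'
        · rw [add_assoc, dyckHeight_node_right h']
          exact (hr.step i h').imp (congrArg (· + 1)) (congrArg (· + 1))
        · rw [dyckHeight_node_of_lt (by omega), hr.beyond i h']
          exact .inr rfl
    · simp only [BinaryTree.numNodes] at hi
      omega

theorem IsDyckHeight.mod_two {n : ℕ} {H : ℕ → ℕ} (h : IsDyckHeight n H) {m : ℕ}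
    (hm : m ≤ 2 * n) : H m % 2 = m % 2 := by
  induction m with
  | zero => simp [h.zero]
  | succ m ih =>
    have := ih (by omega)
    rcases h.step m (by omega) with h | h <;> omega

theorem numNodes_left_le_of_dyckHeight_eq {u u' : Unit} {l r l' r' : BinaryTree Unit}
    (hn : l.numNodes + r.numNodes = l'.numNodes + r'.numNodes)
    (h : dyckHeight (.node u l r) = dyckHeight (.node u' l' r')) :
    l'.numNodes ≤ l.numNodes := by
  by_contra! hlt
  obtain ⟨i, hi⟩ := Nat.exists_eq_add_of_le (show 2 * l.numNodes + 1 ≤ 2 * l'.numNodes by omega)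
  have := congrFun h (2 * l'.numNodes)
  rw [dyckHeight_node_left le_rfl, (isDyckHeight_dyckHeight l').beyond _ le_rfl, hi,
    dyckHeight_node_right (by omega)] at this
  omega

theorem eq_of_dyckHeight_eq {t t' : BinaryTree Unit} (hn : t.numNodes = t'.numNodes)
    (h : dyckHeight t = dyckHeight t') : t = t' := by
  induction t generalizing t' with
  | nil => cases t' with
    | nil => rfl
    | node _ l r => simp at hn
  | node v l r ihl ihr => cases t' with
    | nil => simp at hn
    | node v' l' r' =>
      simp only [BinaryTree.numNodes] at hn
      have hl : l.numNodes = l'.numNodes :=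
        le_antisymm (numNodes_left_le_of_dyckHeight_eq (by omega) h.symm)
          (numNodes_left_le_of_dyckHeight_eq (by omega) h)
      have hr : r.numNodes = r'.numNodes := by omega
      rw [ihl hl, ihr hr]
      · funext i
        by_cases hi : i ≤ 2 * r.numNodes
        · have := congrFun h (2 * l.numNodes + 1 + i)
          rw [dyckHeight_node_right hi, hl, dyckHeight_node_right (hr ▸ hi)] at this
          omega
        · rw [(isDyckHeight_dyckHeight r).beyond i (by omega),
            (isDyckHeight_dyckHeight r').beyond i (by omega)]
      · funext i
        by_cases hi : i ≤ 2 * l.numNodes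
        · have := congrFun h i
          rwa [dyckHeight_node_left hi, dyckHeight_node_left (hl ▸ hi)] at this
        · rw [(isDyckHeight_dyckHeight l).beyond i (by omega),
            (isDyckHeight_dyckHeight l').beyond i (by omega)]

theorem IsDyckHeight.exists_dyckHeight_eq {n : ℕ} {H : ℕ → ℕ} (h : IsDyckHeight n H) :
    ∃ t : BinaryTree Unit, t.numNodes = n ∧ dyckHeight t = H := by
  induction n using Nat.strong_induction_on generalizing H with
  | _ n ih =>
    rcases Nat.eq_zero_or_pos n with rfl | hn
    · exact ⟨.nil, rfl, funext fun i => (h.beyond i (by simp)).symm⟩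
    · obtain ⟨m, hm, hHm, hmax⟩ : ∃ m < 2 * n, H m = 0 ∧ ∀ i, m < i → i < 2 * n → H i ≠ 0 := by
        refine ⟨Nat.findGreatest (fun i => H i = 0) (2 * n - 1), ?_, ?_, ?_⟩
        · have := Nat.findGreatest_le (P := fun i => H i = 0) (2 * n - 1)
          omega
        · exact Nat.findGreatest_spec (P := fun i => H i = 0) (Nat.zero_le _) h.zero
        · exact fun i hi hi' =>
            Nat.findGreatest_is_greatest (P := fun i => H i = 0) hi (by omega)
      obtain ⟨p, rfl⟩ : ∃ p, m = 2 * p := ⟨m / 2, by have := h.mod_two hm.le; omega⟩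
      obtain ⟨q, rfl⟩ : ∃ q, n = p + q + 1 := ⟨n - p - 1, by omega⟩
      have hstep := h.step
      have hbeyond := h.beyond
      obtain ⟨l, hln, hl⟩ := ih p (by omega) (H := fun i => if i ≤ 2 * p then H i else 0)
        ⟨by simp [h.zero], fun i hi => by have := hstep i (by omega); grind, by grind⟩
      obtain ⟨r, hrn, hr⟩ := ih q (by omega)
        (H := fun i => if i ≤ 2 * q then H (i + 2 * p + 1) - 1 else 0)
        ⟨by have := hstep (2 * p) (by omega); grind,
          fun i hi => by
            have h1 := hstep (i + 2 * p + 1) (by omega)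
            have h2 := hmax (i + 2 * p + 1) (by omega) (by omega)
            have h3 := hmax (i + 2 * p + 1 + 1) (by omega) (by omega)
            grind,
          fun i hi => by
            have h1 := hstep (2 * p + 2 * q + 1) (by omega)
            have h2 := hbeyond (2 * p + 2 * q + 2) (by omega)
            grind⟩
      refine ⟨.node () l r, by simp [hln, hrn], funext fun i => ?_⟩
      rcases le_or_gt i (2 * p) with hi | hi
      · rw [dyckHeight_node_left (hln ▸ hi), hl]
        exact if_pos hi
      obtain ⟨i, rfl⟩ := Nat.exists_eq_add_of_le (Nat.succ_le_of_lt hi)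
      rcases le_or_gt i (2 * q) with hi | hi
      · subst hln hrn
        have := hmax (i + 2 * l.numNodes + 1) (by omega) (by omega)
        have e : 2 * l.numNodes + 1 + i = i + 2 * l.numNodes + 1 := by omega
        rw [Nat.succ_eq_add_one, dyckHeight_node_right hi, hr, e]
        simp only [if_pos hi]
        omega
      · rw [dyckHeight_node_of_lt (by omega), hbeyond _ (by omega)]

theorem dyckHeight_le (t : BinaryTree Unit) (m : ℕ) : dyckHeight t m ≤ rightDepth t := by
  induction t generalizing m with
  | nil => simp [dyckHeight]
  | node _ l r hl hr =>
    have h1 := hl m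
    have h2 := hr (m - 2 * l.numNodes - 1)
    simp only [dyckHeight, rightDepth]
    grind

theorem exists_dyckHeight_eq_rightDepth (t : BinaryTree Unit) :
    ∃ m ≤ 2 * t.numNodes, dyckHeight t m = rightDepth t := by
  induction t with
  | nil => exact ⟨0, by simp, rfl⟩
  | node _ l r hl hr =>
    obtain ⟨m, hm, hl⟩ := hl
    obtain ⟨m', hm', hr⟩ := hr
    simp only [rightDepth, BinaryTree.numNodes]
    rcases le_total (rightDepth r + 1) (rightDepth l) with h | h
    · refine ⟨m, by omega, ?_⟩
      rw [dyckHeight_node_left hm, hl, max_eq_left h]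
    · refine ⟨2 * l.numNodes + 1 + m', by omega, ?_⟩
      rw [dyckHeight_node_right hm', hr, max_eq_right h]

/-- The condition that the path with heights `H` has a peak after its first `i + 1` steps. -/
abbrev IsPeakAt (H : ℕ → ℕ) (i : ℕ) : Prop :=
  H (i + 1) = H i + 1 ∧ H (i + 1) = H (i + 1 + 1) + 1

theorem isPeakAt_node_left {u : Unit} {l r : BinaryTree Unit} {i : ℕ}
    (hi : i < 2 * l.numNodes) :
    IsPeakAt (dyckHeight (.node u l r)) i ↔ IsPeakAt (dyckHeight l) i := by
  unfold IsPeakAt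
  rw [dyckHeight_node_left hi.le, dyckHeight_node_left (Nat.add_one_le_iff.mpr hi)]
  rcases eq_or_lt_of_le (Nat.add_one_le_iff.mpr hi) with h | h
  · have := (isDyckHeight_dyckHeight l).beyond (i + 1) h.ge
    omega
  · rw [dyckHeight_node_left (Nat.add_one_le_iff.mpr h)]

theorem isPeakAt_node_right {u : Unit} {l r : BinaryTree Unit} {i : ℕ}
    (hi : i < 2 * r.numNodes) :
    IsPeakAt (dyckHeight (.node u l r)) (2 * l.numNodes + 1 + i) ↔
      IsPeakAt (dyckHeight r) i := by
  unfold IsPeakAt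
  rw [add_assoc _ i 1, add_assoc _ (i + 1) 1]
  rw [dyckHeight_node_right hi.le, dyckHeight_node_right (Nat.add_one_le_iff.mpr hi)]
  rcases eq_or_lt_of_le (Nat.add_one_le_iff.mpr hi) with h | h
  · have := (isDyckHeight_dyckHeight r).beyond (i + 1) h.ge
    omega
  · rw [dyckHeight_node_right (Nat.add_one_le_iff.mpr h)]
    omega

theorem isPeakAt_node_root {u : Unit} {l r : BinaryTree Unit} :
    IsPeakAt (dyckHeight (.node u l r)) (2 * l.numNodes) ↔ r.numNodes = 0 := by
  unfold IsPeakAt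
  have Hr := isDyckHeight_dyckHeight r
  rw [dyckHeight_node_left le_rfl, (isDyckHeight_dyckHeight l).beyond _ le_rfl,
    ← add_zero (2 * l.numNodes + 1), dyckHeight_node_right (Nat.zero_le _), Hr.zero, add_assoc _ 0]
  rcases Nat.eq_zero_or_pos r.numNodes with h | h
  · rw [dyckHeight_node_of_lt (by omega)]
    simp [h]
  · rw [dyckHeight_node_right (by omega)]
    omega

theorem sum_peaks_dyckHeight (t : BinaryTree Unit) :
    (∑ i ∈ Finset.range (2 * t.numNodes), if IsPeakAt (dyckHeight t) i then 1 else 0) =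
      numRightEmpty t := by
  induction t with
  | nil => rfl
  | node v l r hl hr =>
    have e : 2 * (BinaryTree.node v l r).numNodes
        = 2 * l.numNodes + 1 + 2 * r.numNodes + 1 := by
      simp only [BinaryTree.numNodes]; ring
    have hlast : ¬ IsPeakAt (dyckHeight (.node v l r))
        (2 * l.numNodes + 1 + 2 * r.numNodes) := by
      unfold IsPeakAt
      rw [dyckHeight_node_of_lt (Nat.lt_succ_self _)]
      omega
    rw [e, Finset.sum_range_succ, if_neg hlast, Finset.sum_range_add, Finset.sum_range_succ,
      numRightEmpty, ← hl, ← hr]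
    simp only [isPeakAt_node_root]
    rw [Finset.sum_congr rfl fun i hi => if_congr (isPeakAt_node_left (by simpa using hi)) rfl rfl,
      Finset.sum_congr rfl fun i hi => if_congr (isPeakAt_node_right (by simpa using hi)) rfl rfl]
    ring

/-- The steps of the path with heights `H`. -/
def heightSteps (H : ℕ → ℕ) (i : ℕ) : ℤ := H (i + 1) - H i

theorem IsDyckHeight.sum_heightSteps {n : ℕ} {H : ℕ → ℕ} (h : IsDyckHeight n H) (m : ℕ) :
    ∑ i ∈ Finset.range m, heightSteps H i = H m := by
  simp only [heightSteps]
  rw [Finset.sum_range_sub (fun i => (H i : ℤ)), h.zero]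
  simp

theorem IsDyckHeight.isDyckPath {n : ℕ} {H : ℕ → ℕ} (h : IsDyckHeight n H) :
    IsDyckPath n (heightSteps H) := by
  refine ⟨fun i hi => ?_, fun i hi => ?_, fun m _ => ?_, ?_⟩
  · have := h.step i hi
    unfold heightSteps
    omega
  · simp [heightSteps, h.beyond i hi, h.beyond (i + 1) (by omega)]
  · simp [h.sum_heightSteps]
  · simp [h.sum_heightSteps, h.beyond]

theorem IsDyckPath.exists_heightSteps_eq {n : ℕ} {s : ℕ → ℤ} (hs : IsDyckPath n s) :
    ∃ H, IsDyckHeight n H ∧ heightSteps H = s := by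
  obtain ⟨hstep, hbeyond, hnonneg, hzero⟩ := hs
  have hb (m : ℕ) (hm : 2 * n ≤ m) : ∑ i ∈ Finset.range m, s i = 0 := by
    rw [← Finset.sum_subset (Finset.range_mono hm), hzero]
    intro i _ hi
    exact hbeyond i (by simpa using hi)
  have hn (m : ℕ) : 0 ≤ ∑ i ∈ Finset.range m, s i := by
    rcases le_total m (2 * n) with hm | hm
    · exact hnonneg m hm
    · exact (hb m hm).ge
  refine ⟨fun m => (∑ i ∈ Finset.range m, s i).toNat, ⟨by simp, fun i hi => ?_, fun i hi => ?_⟩, ?_⟩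
  · have h1 := hn i
    have h2 := hn (i + 1)
    have h3 := hstep i hi
    rw [Finset.sum_range_succ] at h2
    simp only [Finset.sum_range_succ]
    omega
  · simp [hb i hi]
  · funext i
    rw [heightSteps, Int.toNat_of_nonneg (hn _), Int.toNat_of_nonneg (hn _),
      Finset.sum_range_succ, add_sub_cancel_left]

theorem IsDyckHeight.numPeaks_heightSteps {n : ℕ} {H : ℕ → ℕ} (h : IsDyckHeight n H) :
    numPeaks n (heightSteps H) = ∑ i ∈ Finset.range (2 * n), if IsPeakAt H i then 1 else 0 := by
  rw [← Finset.card_filter]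
  refine Nat.subtype_card _ fun i => ?_
  have h1 := h.beyond (i + 1)
  simp only [Finset.mem_filter, Finset.mem_range, heightSteps, IsPeakAt]
  omega

theorem IsDyckHeight.pathHeight_heightSteps_le {n : ℕ} {H : ℕ → ℕ} (h : IsDyckHeight n H)
    (K : ℕ) : pathHeight n (heightSteps H) ≤ K ↔ ∀ m ≤ 2 * n, H m ≤ K := by
  simp [pathHeight, Finset.sup_le_iff, h.sum_heightSteps]

theorem pathHeight_dyckHeight_le (t : BinaryTree Unit) (K : ℕ) :
    pathHeight t.numNodes (heightSteps (dyckHeight t)) ≤ K ↔ rightDepth t ≤ K := by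
  rw [(isDyckHeight_dyckHeight t).pathHeight_heightSteps_le]
  refine ⟨fun h => ?_, fun h m _ => (dyckHeight_le t m).trans h⟩
  obtain ⟨m, hm, e⟩ := exists_dyckHeight_eq_rightDepth t
  exact e ▸ h m hm

theorem dyckCount_eq_card_tree (n j k : ℕ) :
    dyckCount n j k = Nat.card {t : BinaryTree Unit //
      t.numNodes = n ∧ numRightEmpty t = j ∧ rightDepth t ≤ k} := by
  symm
  refine Nat.card_congr (Equiv.ofBijective (fun t => ⟨heightSteps (dyckHeight t.1), ?_⟩) ⟨?_, ?_⟩)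
  · obtain ⟨t, rfl, ht, hk⟩ := t
    have h := isDyckHeight_dyckHeight t
    exact ⟨h.isDyckPath, by rw [h.numPeaks_heightSteps, sum_peaks_dyckHeight, ht],
      (pathHeight_dyckHeight_le t k).mpr hk⟩
  · rintro ⟨t, rfl, _⟩ ⟨t', ht', _⟩ h
    have h := congrArg Subtype.val h
    refine Subtype.ext (eq_of_dyckHeight_eq ht'.symm (funext fun m => ?_))
    have := congrArg (fun s => ∑ i ∈ Finset.range m, s i) h
    simpa [(isDyckHeight_dyckHeight t).sum_heightSteps,
      (isDyckHeight_dyckHeight t').sum_heightSteps] using this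
  · rintro ⟨s, hs, hj, hk⟩
    obtain ⟨H, hH, rfl⟩ := hs.exists_heightSteps_eq
    obtain ⟨t, rfl, rfl⟩ := hH.exists_dyckHeight_eq
    exact ⟨⟨t, rfl, by rw [← sum_peaks_dyckHeight, ← hH.numPeaks_heightSteps, hj],
      (pathHeight_dyckHeight_le t k).mp hk⟩, rfl⟩

/-! ### 231-avoiding permutations -/

/-- `f` restricts to a 231-avoiding permutation of `{0, …, n - 1}`. -/
structure Is231Avoiding (n : ℕ) (f : ℕ → ℕ) : Prop where
  lt : ∀ i < n, f i < n
  inj : ∀ i < n, ∀ j < n, f i = f j → i = j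
  avoid : ∀ i j k, i < j → j < k → k < n → f i < f j → f i ≤ f k

/-- The 231-avoiding permutation of a binary tree, where a node stands for the permutation of its
left subtree, followed by the maximum and by the shifted permutation of its right subtree. -/
def permFun : BinaryTree Unit → ℕ → ℕ
  | .nil, _ => 0
  | .node _ l r, i =>
    if i < l.numNodes then permFun l i
    else if i = l.numNodes then l.numNodes + r.numNodes
    else l.numNodes + permFun r (i - l.numNodes - 1)

section node

variable {u : Unit} {l r : BinaryTree Unit}

theorem permFun_node_left {i : ℕ} (hi : i < l.numNodes) :
    permFun (.node u l r) i = permFun l i := by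
  simp [permFun, hi]

theorem permFun_node_root : permFun (.node u l r) l.numNodes = l.numNodes + r.numNodes := by
  simp [permFun]

theorem permFun_node_right (i : ℕ) :
    permFun (.node u l r) (l.numNodes + 1 + i) = l.numNodes + permFun r i := by
  have e : l.numNodes + 1 + i - l.numNodes - 1 = i := by omega
  rw [permFun, if_neg (by omega), if_neg (by omega), e]

end node

theorem lt_or_eq_or_exists_add {p q i : ℕ} (hi : i < p + q + 1) :
    i < p ∨ i = p ∨ ∃ i' < q, i = p + 1 + i' := by
  rcases lt_trichotomy i p with h | h | h
  · exact .inl h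
  · exact .inr (.inl h)
  · exact .inr (.inr ⟨i - p - 1, by omega, by omega⟩)

theorem is231Avoiding_permFun (t : BinaryTree Unit) :
    Is231Avoiding t.numNodes (permFun t) := by
  induction t with
  | nil => exact ⟨by simp, by simp, by simp⟩
  | node v l r hl hr =>
    have hcases (i : ℕ) (hi : i < l.numNodes + r.numNodes + 1) :
        (i < l.numNodes ∧ permFun (.node v l r) i = permFun l i ∧ permFun l i < l.numNodes) ∨
        (i = l.numNodes ∧ permFun (.node v l r) i = l.numNodes + r.numNodes) ∨
        ∃ i' < r.numNodes, i = l.numNodes + 1 + i' ∧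
          permFun (.node v l r) i = l.numNodes + permFun r i' ∧ permFun r i' < r.numNodes := by
      rcases lt_or_eq_or_exists_add hi with h | rfl | ⟨i, h, rfl⟩
      · exact .inl ⟨h, permFun_node_left h, hl.lt i h⟩
      · exact .inr (.inl ⟨rfl, permFun_node_root⟩)
      · exact .inr (.inr ⟨i, h, rfl, permFun_node_right i, hr.lt i h⟩)
    simp only [BinaryTree.numNodes]
    refine ⟨fun i hi => ?_, fun i hi j hj h => ?_, fun i j k hij hjk hk h => ?_⟩
    · have := hcases i hi
      omega
    · rcases hcases i hi with hi | hi | ⟨i', hi', hi⟩ <;>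
        rcases hcases j hj with hj | hj | ⟨j', hj', hj⟩ <;> try omega
      · exact hl.inj i hi.1 j hj.1 (by omega)
      · have := hr.inj i' hi' j' hj' (by omega)
        omega
    · rcases hcases i (by omega) with hi | hi | ⟨i', hi', hi⟩ <;>
        rcases hcases j (by omega) with hj | hj | ⟨j', hj', hj⟩ <;>
        rcases hcases k hk with hk | hk | ⟨k', hk', hk⟩ <;> try omega
      · have := hl.avoid i j k hij hjk hk.1 (by omega)
        omega
      · have := hr.avoid i' j' k' (by omega) (by omega) hk' (by omega)
        omega

theorem numNodes_left_eq_of_permFun_eq {u u' : Unit} {l r l' r' : BinaryTree Unit}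
    (hn : l.numNodes + r.numNodes = l'.numNodes + r'.numNodes)
    (h : ∀ i < l.numNodes + r.numNodes + 1,
      permFun (.node u l r) i = permFun (.node u' l' r') i) :
    l.numNodes = l'.numNodes := by
  refine (is231Avoiding_permFun (.node u l r)).inj _ ?_ _ ?_ ?_
  · simp only [BinaryTree.numNodes]
    omega
  · simp only [BinaryTree.numNodes]
    omega
  · rw [permFun_node_root, h _ (by omega), permFun_node_root, hn]

theorem eq_of_permFun_eq {t t' : BinaryTree Unit} (hn : t.numNodes = t'.numNodes)
    (h : ∀ i < t.numNodes, permFun t i = permFun t' i) : t = t' := by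
  induction t generalizing t' with
  | nil => cases t' with
    | nil => rfl
    | node _ l r => simp at hn
  | node v l r ihl ihr => cases t' with
    | nil => simp at hn
    | node v' l' r' =>
      simp only [BinaryTree.numNodes] at hn h
      have hl : l.numNodes = l'.numNodes := numNodes_left_eq_of_permFun_eq (by omega) h
      have hr : r.numNodes = r'.numNodes := by omega
      rw [ihl hl fun i hi => ?_, ihr hr fun i hi => ?_]
      · have := h (l.numNodes + 1 + i) (by omega)
        rw [permFun_node_right, hl, permFun_node_right] at this
        omega
      · have := h i (by omega)
        rwa [permFun_node_left hi, permFun_node_left (hl ▸ hi)] at this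

theorem Is231Avoiding.lt_of_lt_of_max {n : ℕ} {f : ℕ → ℕ} (h : Is231Avoiding (n + 1) f) {p : ℕ}
    (hp : f p = n) (hpn : p < n + 1) {i k : ℕ} (hi : i < p) (hk : p ≤ k) (hkn : k < n + 1) :
    f i < f k := by
  have hne (j : ℕ) (hj : j < n + 1) (hij : i ≠ j) : f i ≠ f j :=
    fun e => hij (h.inj i (by omega) j hj e)
  have h1 := h.lt i (by omega)
  have h2 := hne p hpn (by omega)
  have h3 := hne k hkn (by omega)
  rcases hk.eq_or_lt with rfl | hk
  · omega
  · have := h.avoid i p k hi hk hkn (by omega)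
    omega

theorem Is231Avoiding.lt_of_lt_max {n : ℕ} {f : ℕ → ℕ} (h : Is231Avoiding (n + 1) f) {p : ℕ}
    (hp : f p = n) (hpn : p < n + 1) {i : ℕ} (hi : i < p) : f i < p := by
  have := Finset.card_le_card_of_injOn (s := Finset.Ico p (n + 1))
    (t := Finset.Ico (f i + 1) (n + 1)) f
    (fun k hk => by
      simp only [Finset.coe_Ico, Set.mem_Ico] at hk ⊢
      exact ⟨h.lt_of_lt_of_max hp hpn hi hk.1 hk.2, h.lt k hk.2⟩)
    (fun k hk k' hk' e => by
      simp only [Finset.coe_Ico, Set.mem_Ico] at hk hk'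
      exact h.inj k hk.2 k' hk'.2 e)
  simp only [Nat.card_Ico] at this
  omega

theorem Is231Avoiding.le_of_max_lt {n : ℕ} {f : ℕ → ℕ} (h : Is231Avoiding (n + 1) f) {p : ℕ}
    (hp : f p = n) (hpn : p < n + 1) {k : ℕ} (hk : p ≤ k) (hkn : k < n + 1) : p ≤ f k := by
  have := Finset.card_le_card_of_injOn (s := Finset.range p) (t := Finset.range (f k)) f
    (fun i hi => by
      simp only [Finset.coe_range, Set.mem_Iio] at hi ⊢
      exact h.lt_of_lt_of_max hp hpn hi hk hkn)
    (fun i hi i' hi' e => by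
      simp only [Finset.coe_range, Set.mem_Iio] at hi hi'
      exact h.inj i (by omega) i' (by omega) e)
  simpa using this

theorem Is231Avoiding.exists_eq {n : ℕ} {f : ℕ → ℕ} (h : Is231Avoiding (n + 1) f) :
    ∃ p < n + 1, f p = n := by
  have := Finset.surj_on_of_inj_on_of_card_le (s := Finset.range (n + 1))
    (t := Finset.range (n + 1)) (fun i _ => f i)
    (fun i hi => by simpa using h.lt i (by simpa using hi))
    (fun i j hi hj e => h.inj i (by simpa using hi) j (by simpa using hj) e) le_rfl n (by simp)
  obtain ⟨p, hp, e⟩ := this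
  exact ⟨p, by simpa using hp, e.symm⟩

theorem Is231Avoiding.exists_permFun_eq {n : ℕ} {f : ℕ → ℕ} (h : Is231Avoiding n f) :
    ∃ t : BinaryTree Unit, t.numNodes = n ∧ ∀ i < n, permFun t i = f i := by
  induction n using Nat.strong_induction_on generalizing f with
  | _ n ih =>
    rcases n with _ | n
    · exact ⟨.nil, rfl, by simp⟩
    · obtain ⟨p, hpn, hp⟩ := h.exists_eq
      obtain ⟨q, rfl⟩ : ∃ q, n = p + q := ⟨n - p, by omega⟩
      obtain ⟨l, rfl, hl⟩ := ih p (by omega) (f := f)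
        ⟨fun i hi => h.lt_of_lt_max hp hpn hi,
          fun i hi j hj e => h.inj i (by omega) j (by omega) e,
          fun i j k hij hjk hk e => h.avoid i j k hij hjk (by omega) e⟩
      have hge (i : ℕ) (hi : i < q) : l.numNodes ≤ f (l.numNodes + 1 + i) :=
        h.le_of_max_lt hp hpn (by omega) (by omega)
      obtain ⟨r, rfl, hr⟩ := ih q (by omega) (f := fun i => f (l.numNodes + 1 + i) - l.numNodes)
        ⟨fun i hi => by
            have h1 := hge i hi
            have h2 := h.lt (l.numNodes + 1 + i) (by omega)
            have h3 : f (l.numNodes + 1 + i) ≠ f l.numNodes :=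
              fun e => by have := h.inj _ (by omega) _ (by omega) e; omega
            omega,
          fun i hi j hj e => by
            have h1 := hge i hi
            have h2 := hge j hj
            have := h.inj (l.numNodes + 1 + i) (by omega) (l.numNodes + 1 + j) (by omega)
              (by omega)
            omega,
          fun i j k hij hjk hk e => by
            have := h.avoid (l.numNodes + 1 + i) (l.numNodes + 1 + j) (l.numNodes + 1 + k)
              (by omega) (by omega) (by omega) (by omega)
            omega⟩
      refine ⟨.node () l r, rfl, fun i hi => ?_⟩
      rcases lt_or_eq_or_exists_add hi with hi | rfl | ⟨i, hir, rfl⟩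
      · rw [permFun_node_left hi, hl i hi]
      · rw [permFun_node_root, hp]
      · rw [permFun_node_right, hr i hir, Nat.add_sub_cancel' (hge i hir)]

/-- The condition that `i` is a descent of the restriction of `f` to `{0, …, n - 1}`. -/
abbrev IsDescentAt (n : ℕ) (f : ℕ → ℕ) (i : ℕ) : Prop := i + 1 < n ∧ f (i + 1) < f i

theorem isDescentAt_node_left {u : Unit} {l r : BinaryTree Unit} {i : ℕ} (hi : i < l.numNodes) :
    IsDescentAt (BinaryTree.node u l r).numNodes (permFun (.node u l r)) i ↔
      IsDescentAt l.numNodes (permFun l) i := by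
  have h1 := (is231Avoiding_permFun l).lt i hi
  simp only [IsDescentAt, BinaryTree.numNodes]
  rw [permFun_node_left hi]
  rcases eq_or_lt_of_le (Nat.add_one_le_iff.mpr hi) with h | h
  · rw [h, permFun_node_root]
    omega
  · rw [permFun_node_left h]
    omega

theorem isDescentAt_node_root {u : Unit} {l r : BinaryTree Unit} :
    IsDescentAt (BinaryTree.node u l r).numNodes (permFun (.node u l r)) l.numNodes ↔
      ¬ r.numNodes = 0 := by
  have := (is231Avoiding_permFun r).lt 0
  simp only [IsDescentAt, BinaryTree.numNodes]
  rw [permFun_node_root, ← add_zero (l.numNodes + 1), permFun_node_right]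
  omega

theorem isDescentAt_node_right {u : Unit} {l r : BinaryTree Unit} {i : ℕ} :
    IsDescentAt (BinaryTree.node u l r).numNodes (permFun (.node u l r)) (l.numNodes + 1 + i) ↔
      IsDescentAt r.numNodes (permFun r) i := by
  simp only [IsDescentAt, BinaryTree.numNodes, add_assoc _ i 1, permFun_node_right]
  omega

theorem sum_descents_permFun (t : BinaryTree Unit) :
    (∑ i ∈ Finset.range t.numNodes, if IsDescentAt t.numNodes (permFun t) i then 1 else 0) =
      numRightFull t := by
  induction t with
  | nil => rfl
  | node v l r hl hr =>
    have e : (BinaryTree.node v l r).numNodes = l.numNodes + 1 + r.numNodes := by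
      simp only [BinaryTree.numNodes]; ring
    rw [congrArg Finset.range e, Finset.sum_range_add, Finset.sum_range_succ, numRightFull,
      ← hl, ← hr]
    simp only [isDescentAt_node_root, isDescentAt_node_right, ite_not]
    rw [Finset.sum_congr rfl fun i hi =>
      if_congr (isDescentAt_node_left (by simpa using hi)) rfl rfl]
    ring

theorem add_one_le_permFun_add_rightDepth (t : BinaryTree Unit) {i : ℕ} (hi : i < t.numNodes) :
    i + 1 ≤ permFun t i + rightDepth t := by
  induction t generalizing i with
  | nil => simp at hi
  | node _ l r hl hr =>
    rcases lt_or_eq_or_exists_add hi with hi | rfl | ⟨i, hir, rfl⟩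
    · have := hl hi
      rw [permFun_node_left hi, rightDepth]
      omega
    · rw [permFun_node_root, rightDepth]
      omega
    · have := hr hir
      rw [permFun_node_right, rightDepth]
      omega

theorem exists_add_one_eq_permFun_add_rightDepth (t : BinaryTree Unit) (ht : 0 < t.numNodes) :
    ∃ i < t.numNodes, i + 1 = permFun t i + rightDepth t := by
  induction t with
  | nil => simp at ht
  | node _ l r hl hr =>
    simp only [rightDepth, BinaryTree.numNodes]
    rcases le_or_gt (rightDepth r + 1) (rightDepth l) with h | h
    · obtain ⟨i, hi, e⟩ := hl (by
        by_contra! hl0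
        have := rightDepth_eq_zero l (by omega)
        omega)
      refine ⟨i, by omega, ?_⟩
      rw [permFun_node_left hi]
      omega
    · rcases Nat.eq_zero_or_pos r.numNodes with h0 | h0
      · refine ⟨l.numNodes, by omega, ?_⟩
        have := rightDepth_eq_zero r h0
        rw [permFun_node_root]
        omega
      · obtain ⟨i, hi, e⟩ := hr h0
        refine ⟨l.numNodes + 1 + i, by omega, ?_⟩
        rw [permFun_node_right]
        omega

theorem des_eq_sum {n : ℕ} {σ : Equiv.Perm (Fin n)} {f : ℕ → ℕ}
    (hf : ∀ i : Fin n, f i = σ i) :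
    des σ = ∑ i ∈ Finset.range n, if IsDescentAt n f i then 1 else 0 := by
  rw [← Fin.sum_univ_eq_sum_range (fun i => if IsDescentAt n f i then 1 else 0),
    ← Finset.card_filter]
  refine Nat.subtype_card _ fun i => ?_
  simp only [Finset.mem_filter, Finset.mem_univ, true_and, IsDescentAt, hf i]
  constructor
  · rintro ⟨h, h'⟩
    exact ⟨h, by rwa [Fin.lt_def, ← hf]⟩
  · rintro ⟨h, h'⟩
    exact ⟨h, by rwa [Fin.lt_def, ← hf] at h'⟩

theorem avoids231.is231Avoiding {n : ℕ} {σ : Equiv.Perm (Fin n)} (hσ : avoids231 σ) {f : ℕ → ℕ}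
    (hf : ∀ i : Fin n, f i = σ i) : Is231Avoiding n f := by
  refine ⟨fun i hi => ?_, fun i hi j hj h => ?_, fun i j k hij hjk hk h => ?_⟩
  · rw [hf ⟨i, hi⟩]
    exact (σ _).isLt
  · rw [hf ⟨i, hi⟩, hf ⟨j, hj⟩] at h
    simpa using σ.injective (Fin.ext h)
  · by_contra! hlt
    refine hσ ⟨⟨i, by omega⟩, ⟨j, by omega⟩, ⟨k, hk⟩, hij, hjk, ?_, ?_⟩ <;>
      rwa [Fin.lt_def, ← hf, ← hf]

/-- The permutation of `Fin n` given by a 231-avoiding function. -/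
noncomputable def Is231Avoiding.toPerm {n : ℕ} {f : ℕ → ℕ} (h : Is231Avoiding n f) :
    Equiv.Perm (Fin n) :=
  Equiv.ofBijective (fun i => ⟨f i, h.lt i i.isLt⟩) <| Finite.injective_iff_bijective.mp
    fun i j e => Fin.ext (h.inj i i.isLt j j.isLt (congrArg Fin.val e))

theorem Is231Avoiding.toPerm_apply {n : ℕ} {f : ℕ → ℕ} (h : Is231Avoiding n f) (i : Fin n) :
    f i = h.toPerm i := rfl

theorem Is231Avoiding.avoids231_toPerm {n : ℕ} {f : ℕ → ℕ} (h : Is231Avoiding n f) :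
    avoids231 h.toPerm := by
  rintro ⟨i, j, k, hij, hjk, hki, hij'⟩
  exact (h.avoid i j k hij hjk k.isLt hij').not_gt hki

theorem maxDrop_le {n : ℕ} {σ : Equiv.Perm (Fin n)} {f : ℕ → ℕ}
    (hf : ∀ i : Fin n, f i = σ i) (k : ℕ) : maxDrop σ ≤ k ↔ ∀ i < n, i ≤ f i + k := by
  simp only [maxDrop, Finset.sup_le_iff, Finset.mem_univ, true_implies, ← hf]
  refine ⟨fun h i hi => ?_, fun h i => ?_⟩
  · have := h ⟨i, hi⟩
    dsimp only at this
    omega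
  · have := h i i.isLt
    omega

theorem forall_le_permFun_add_iff (t : BinaryTree Unit) (ht : 0 < t.numNodes) (k : ℕ) :
    (∀ i < t.numNodes, i ≤ permFun t i + k) ↔ rightDepth t ≤ k + 1 := by
  refine ⟨fun h => ?_, fun h i hi => ?_⟩
  · obtain ⟨i, hi, e⟩ := exists_add_one_eq_permFun_add_rightDepth t ht
    have := h i hi
    omega
  · have := add_one_le_permFun_add_rightDepth t hi
    omega

theorem a_eq_card_tree (n j k : ℕ) (hn : 1 ≤ n) :
    a n j k = Nat.card {t : BinaryTree Unit //
      t.numNodes = n ∧ numRightFull t = j ∧ rightDepth t ≤ k + 1} := by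
  symm
  refine Nat.card_congr (Equiv.ofBijective
    (fun t => ⟨(t.2.1.subst (motive := (Is231Avoiding · (permFun t.1)))
      (is231Avoiding_permFun t.1)).toPerm, ?_⟩)
    ⟨?_, ?_⟩)
  · obtain ⟨t, rfl, ht, hk⟩ := t
    have h := is231Avoiding_permFun t
    exact ⟨h.avoids231_toPerm, by rw [des_eq_sum h.toPerm_apply, sum_descents_permFun, ht],
      by rwa [maxDrop_le h.toPerm_apply, forall_le_permFun_add_iff t hn]⟩
  · rintro ⟨t, rfl, _⟩ ⟨t', ht', _⟩ h
    refine Subtype.ext (eq_of_permFun_eq ht'.symm fun i hi => ?_)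
    exact congrArg Fin.val (DFunLike.congr_fun (congrArg Subtype.val h) ⟨i, hi⟩)
  · rintro ⟨σ, hσ, hj, hk⟩
    obtain ⟨f, hf⟩ : ∃ f : ℕ → ℕ, ∀ i : Fin n, f i = σ i :=
      ⟨fun i => if h : i < n then σ ⟨i, h⟩ else 0, by simp⟩
    obtain ⟨t, rfl, ht⟩ := (hσ.is231Avoiding hf).exists_permFun_eq
    have hσt (i : Fin t.numNodes) : permFun t i = σ i := by rw [ht i i.isLt, hf]
    refine ⟨⟨t, rfl, ?_, ?_⟩, Subtype.ext (Equiv.ext fun i => Fin.ext (hσt i))⟩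
    · rw [← sum_descents_permFun, ← des_eq_sum hσt, hj]
    · rwa [← forall_le_permFun_add_iff t hn, ← maxDrop_le hσt]

theorem a_eq_dyckCount (n j k : ℕ) (hn : 1 ≤ n) :
    a n j k = dyckCount n (n - j) (k + 1) := by
  rw [a_eq_card_tree n j k hn, dyckCount_eq_card_tree]
  refine Nat.card_congr (Equiv.subtypeEquivRight fun t => and_congr_right fun ht => ?_)
  have h1 := numRightFull_add_numRightEmpty t
  have h2 := numRightEmpty_pos t (by omega)
  exact and_congr_left fun _ => by omega
end

section
/- For all n, j ≥ 1 and all k ≥ j, the number a_{n,j}^{(k)} of 231-avoiding permutations σ of {1,…,n} with des(σ) = j and md(σ) ≤ k equals the Narayana number (1/n)·C(n, j)·C(n, j+1); equivalently, n · a_{n,j}^{(k)} = C(n, j)·C(n, j+1). -/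
open Finset Polynomial

namespace BinaryTree

/-- The number of nodes with a nonempty right child. -/
def rightEdges : BinaryTree Unit → ℕ
  | nil => 0
  | node _ l r => l.rightEdges + r.rightEdges + if r.numNodes = 0 then 0 else 1

/-- The one-line notation, with positions and values counted from `0`, of the 231-avoiding
permutation of a tree: the left subtree, then the maximum, then the right subtree shifted up. -/
def word : BinaryTree Unit → ℕ → ℕ
  | nil, _ => 0
  | node _ l r, i =>
    if i < l.numNodes then l.word i
    else if i = l.numNodes then l.numNodes + r.numNodes
    else l.numNodes + r.word (i - l.numNodes - 1)

section word

variable (l r : BinaryTree Unit)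

theorem word_node_left (u : Unit) {i : ℕ} (h : i < l.numNodes) :
    (node u l r).word i = l.word i := by
  simp [word, h]

theorem word_node_root (u : Unit) :
    (node u l r).word l.numNodes = l.numNodes + r.numNodes := by
  simp [word]

theorem word_node_right (u : Unit) (i : ℕ) :
    (node u l r).word (l.numNodes + 1 + i) = l.numNodes + r.word i := by
  have h₁ : ¬ l.numNodes + 1 + i < l.numNodes := by omega
  have h₂ : l.numNodes + 1 + i ≠ l.numNodes := by omega
  have h₃ : l.numNodes + 1 + i - l.numNodes - 1 = i := by omega
  simp only [word, if_neg h₁, if_neg h₂, h₃]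

end word

theorem node_position_cases {p q i : ℕ} (h : i < p + q + 1) :
    i < p ∨ i = p ∨ ∃ j < q, i = p + 1 + j := by
  rcases lt_trichotomy i p with h' | h' | h'
  · exact .inl h'
  · exact .inr (.inl h')
  · exact .inr (.inr ⟨i - p - 1, by omega, by omega⟩)

theorem word_lt (t : BinaryTree Unit) : ∀ i < t.numNodes, t.word i < t.numNodes := by
  induction t with
  | nil => simp
  | node u l r ihl ihr =>
    intro i hi
    simp only [numNodes] at hi ⊢
    rcases node_position_cases hi with h | rfl | ⟨j, hj, rfl⟩
    · have := ihl i h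
      rw [word_node_left _ _ _ h]; omega
    · rw [word_node_root]; omega
    · have := ihr j hj
      rw [word_node_right]; omega

theorem word_injOn (t : BinaryTree Unit) :
    ∀ i < t.numNodes, ∀ j < t.numNodes, t.word i = t.word j → i = j := by
  induction t with
  | nil => simp
  | node u l r ihl ihr =>
    intro i hi j hj
    simp only [numNodes] at hi hj
    have hl := word_lt l
    have hr := word_lt r
    rcases node_position_cases hi with h | rfl | ⟨i, h, rfl⟩ <;>
    rcases node_position_cases hj with h' | rfl | ⟨j, h', rfl⟩ <;>
    simp only [word_node_left _ _ _, word_node_root, word_node_right, *] <;> grind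

theorem word_avoids (t : BinaryTree Unit) :
    ∀ i j k, i < j → j < k → k < t.numNodes → t.word k < t.word i → ¬ t.word i < t.word j := by
  induction t with
  | nil => simp
  | node u l r ihl ihr =>
    intro i j k hij hjk hk
    simp only [numNodes] at hk
    have hl := word_lt l
    have hr := word_lt r
    rcases node_position_cases (hij.trans (hjk.trans hk)) with h | rfl | ⟨i, h, rfl⟩ <;>
    rcases node_position_cases (hjk.trans hk) with h' | rfl | ⟨j, h', rfl⟩ <;>
    rcases node_position_cases hk with h'' | rfl | ⟨k, h'', rfl⟩ <;>
    simp only [word_node_left _ _ _, word_node_root, word_node_right, *] <;> grind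

theorem sum_descents_word (t : BinaryTree Unit) :
    ∑ i ∈ range (t.numNodes - 1), (if t.word (i + 1) < t.word i then 1 else 0) =
      t.rightEdges := by
  induction t with
  | nil => simp [rightEdges]
  | node u l r ihl ihr =>
    simp only [numNodes, rightEdges, Nat.add_sub_cancel]
    rw [sum_range_add]
    have hleft : ∑ i ∈ range l.numNodes,
        (if (node u l r).word (i + 1) < (node u l r).word i then 1 else 0) = l.rightEdges := by
      rcases Nat.eq_zero_or_eq_succ_pred l.numNodes with h0 | h0
      · rw [← ihl, h0]; simp
      · rw [← ihl]
        conv_lhs => rw [h0]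
        rw [sum_range_succ]
        have h1 : l.numNodes.pred + 1 = l.numNodes := h0.symm
        rw [h1, word_node_root, word_node_left _ _ _ (by omega), if_neg, add_zero]
        · refine sum_congr rfl fun i hi => ?_
          rw [mem_range] at hi
          rw [word_node_left _ _ _ (by omega), word_node_left _ _ _ (by omega)]
        · have := word_lt l l.numNodes.pred (by omega)
          omega
    have hright : ∑ i ∈ range r.numNodes, (if (node u l r).word (l.numNodes + i + 1) <
          (node u l r).word (l.numNodes + i) then 1 else 0) =
        r.rightEdges + if r.numNodes = 0 then 0 else 1 := by
      rcases Nat.eq_zero_or_eq_succ_pred r.numNodes with h0 | h0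
      · rw [← ihr, h0]; simp
      · rw [← ihr]
        conv_lhs => rw [h0]
        have h2 := word_node_right l r u 0
        have h3 := word_lt r 0 (by omega)
        simp only [add_zero] at h2
        rw [sum_range_succ', if_neg (show r.numNodes ≠ 0 by omega), add_zero, h2,
          word_node_root, if_pos (by omega)]
        congr 1
        refine sum_congr rfl fun i hi => ?_
        rw [show l.numNodes + (i + 1) + 1 = l.numNodes + 1 + (i + 1) by ring,
          show l.numNodes + (i + 1) = l.numNodes + 1 + i by ring, word_node_right,
          word_node_right]
        simp
    rw [hleft, hright, add_assoc]

theorem le_word_add_rightEdges (t : BinaryTree Unit) :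
    ∀ i < t.numNodes, i ≤ t.word i + t.rightEdges := by
  induction t with
  | nil => simp
  | node u l r ihl ihr =>
    intro i hi
    simp only [numNodes] at hi
    rcases node_position_cases hi with h | rfl | ⟨j, hj, rfl⟩
    · have := ihl i h
      simp only [word_node_left _ _ _ h, rightEdges]; omega
    · simp only [word_node_root]; omega
    · have := ihr j hj
      simp only [word_node_right, rightEdges, if_neg (show r.numNodes ≠ 0 by omega)]; omega

theorem eq_of_word_eq (s : BinaryTree Unit) : ∀ t : BinaryTree Unit,
    s.numNodes = t.numNodes → (∀ i < s.numNodes, s.word i = t.word i) → s = t := by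
  induction s with
  | nil => intro t ht _; cases t <;> simp_all
  | node u l r ihl ihr =>
    intro t ht h
    cases t with
    | nil => simp at ht
    | node v l' r' =>
      simp only [numNodes] at ht h
      have hroot : l.numNodes = l'.numNodes := by
        refine word_injOn (node v l' r') _ (by simp only [numNodes]; omega) _
          (by simp only [numNodes]; omega) ?_
        rw [← h _ (by omega), word_node_root, word_node_root]
        omega
      have hl : l = l' := by
        refine ihl _ hroot fun i hi => ?_
        have := h i (by omega)
        rwa [word_node_left _ _ _ hi, word_node_left _ _ _ (by omega)] at this
      subst hl
      have hr : r = r' := by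
        refine ihr _ (by omega) fun i hi => ?_
        have := h (l.numNodes + 1 + i) (by omega)
        rw [word_node_right, word_node_right] at this
        omega
      rw [hr]

/-- If `m` distinct values of `g` all lie in an interval, the interval has length at least `m`. -/
theorem le_of_injOn_of_mapsTo_Ico {g : ℕ → ℕ} {c d e f : ℕ}
    (hinj : ∀ i ∈ Ico c d, ∀ j ∈ Ico c d, g i = g j → i = j)
    (hmaps : ∀ i ∈ Ico c d, g i ∈ Ico e f) : d - c ≤ f - e := by
  have := card_le_card_of_injOn g hmaps (fun i hi j hj h => hinj i hi j hj h)
  simpa using this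

theorem exists_word_eq (n : ℕ) : ∀ g : ℕ → ℕ, (∀ i < n, g i < n) →
    (∀ i < n, ∀ j < n, g i = g j → i = j) →
    (∀ i j k, i < j → j < k → k < n → g k < g i → ¬ g i < g j) →
    ∃ t : BinaryTree Unit, t.numNodes = n ∧ ∀ i < n, t.word i = g i := by
  induction n using Nat.strong_induction_on with
  | _ n ih =>
  intro g hlt hinj hav
  rcases n with _ | n
  · exact ⟨nil, by simp⟩
  obtain ⟨p, hp, hgp⟩ : ∃ p, p < n + 1 ∧ g p = n := by
    have hsurj := surj_on_of_inj_on_of_card_le (s := range (n + 1)) (t := range (n + 1))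
      (fun i _ => g i) (fun i hi => by simpa using hlt i (by simpa using hi))
      (fun i j hi hj h => hinj i (by simpa using hi) j (by simpa using hj) h) le_rfl n (by simp)
    obtain ⟨p, hp, h⟩ := hsurj
    exact ⟨p, by simpa using hp, h.symm⟩
  have hmax : ∀ i < n + 1, i ≠ p → g i < n := fun i hi hip => by
    have h₁ := hlt i hi
    have h₂ : g i ≠ n := fun h => hip (hinj i hi p hp (h.trans hgp.symm))
    omega
  have hsep : ∀ i < p, ∀ k, p < k → k < n + 1 → g i < g k := fun i hi k hk hkn => by
    have h₁ := hav i p k hi hk hkn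
    have h₂ := hmax i (by omega) (by omega)
    have h₃ : g i ≠ g k := fun h => by
      have := hinj i (by omega) k hkn h
      omega
    omega
  have hleft : ∀ i < p, g i < p := fun i hi => by
    have := le_of_injOn_of_mapsTo_Ico (g := g) (c := p) (d := n + 1) (e := g i + 1) (f := n + 1)
      (fun a ha b hb => hinj a (by grind) b (by grind)) (fun k hk => by
        have := hsep i hi k
        have := hmax i (by omega) (by omega)
        have := hlt k
        grind)
    omega
  have hright : ∀ k, p < k → k < n + 1 → p ≤ g k := fun k hk hkn => by
    have := le_of_injOn_of_mapsTo_Ico (g := g) (c := 0) (d := p) (e := 0) (f := g k)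
      (fun a ha b hb => hinj a (by grind) b (by grind)) (fun i hi => by
        have := hsep i (by grind) k hk hkn
        grind)
    omega
  obtain ⟨l, hl, hlw⟩ := ih p hp g hleft (fun i hi j hj => hinj i (by omega) j (by omega))
    (fun i j k hij hjk hk => hav i j k hij hjk (by omega))
  obtain ⟨r, hr, hrw⟩ := ih (n - p) (by omega) (fun i => g (p + 1 + i) - p)
    (fun i hi => by
      have := hmax (p + 1 + i) (by omega) (by omega)
      omega)
    (fun i hi j hj h => by
      have h₁ := hright (p + 1 + i) (by omega) (by omega)
      have h₂ := hright (p + 1 + j) (by omega) (by omega)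
      have := hinj (p + 1 + i) (by omega) (p + 1 + j) (by omega) (by omega)
      omega)
    (fun i j k hij hjk hk => by
      have h₁ := hright (p + 1 + i) (by omega) (by omega)
      have h₂ := hright (p + 1 + j) (by omega) (by omega)
      have h₃ := hright (p + 1 + k) (by omega) (by omega)
      have := hav (p + 1 + i) (p + 1 + j) (p + 1 + k) (by omega) (by omega) (by omega)
      omega)
  refine ⟨node () l r, by simp only [numNodes]; omega, fun i hi => ?_⟩
  subst hl
  rcases node_position_cases (p := l.numNodes) (q := r.numNodes) (i := i) (by omega)
    with h | rfl | ⟨j, hj, rfl⟩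
  · rw [word_node_left _ _ _ h, hlw i h]
  · rw [word_node_root]; omega
  · have h₁ := hright (l.numNodes + 1 + j) (by omega) (by omega)
    rw [word_node_right, hrw j (by omega)]
    omega

/-- The generating polynomial of `rightEdges` over trees with `n` nodes. -/
noncomputable def rightEdgesPoly (n : ℕ) : ℤ[X] :=
  ∑ t ∈ treesOfNumNodesEq n, X ^ t.rightEdges

theorem coeff_rightEdgesPoly (n j : ℕ) :
    (rightEdgesPoly n).coeff j = #{t ∈ treesOfNumNodesEq n | t.rightEdges = j} := by
  simp only [rightEdgesPoly, finsetSum_coeff, coeff_X_pow, card_filter, eq_comm (a := j)]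
  push_cast
  rfl

theorem rightEdgesPoly_zero : rightEdgesPoly 0 = 1 := by
  simp [rightEdgesPoly, rightEdges]

theorem rightEdgesPoly_succ (n : ℕ) :
    rightEdgesPoly (n + 1) = ∑ p ∈ antidiagonal n,
      rightEdgesPoly p.1 * if p.2 = 0 then 1 else X * rightEdgesPoly p.2 := by
  rw [rightEdgesPoly, treesOfNumNodesEq_succ, sum_biUnion]
  · refine sum_congr rfl fun p _ => ?_
    rw [sum_map, sum_product, rightEdgesPoly, sum_mul]
    refine sum_congr rfl fun l _ => ?_
    split_ifs with h
    · simp only [h, treesOfNumNodesEq_zero, sum_singleton, mul_one]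
      change X ^ (node () l nil).rightEdges = _
      simp [rightEdges]
    · rw [rightEdgesPoly, mul_sum, mul_sum]
      refine sum_congr rfl fun r hr => ?_
      rw [mem_treesOfNumNodesEq] at hr
      change X ^ (node () l r).rightEdges = _
      simp only [rightEdges, hr, if_neg h]
      ring
  · simp_rw [Set.PairwiseDisjoint, Set.Pairwise, disjoint_left]
    aesop

/-- The generating series of nonempty trees by number of nodes and of right edges. -/
noncomputable def narayanaSeries : PowerSeries ℤ[X] :=
  PowerSeries.mk fun n => if n = 0 then 0 else rightEdgesPoly n

theorem narayanaSeries_eq : narayanaSeries =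
    PowerSeries.X * ((1 + narayanaSeries) * (1 + PowerSeries.C X * narayanaSeries)) := by
  ext1 n
  rcases n with _ | n
  · simp [narayanaSeries]
  · rw [PowerSeries.coeff_succ_X_mul, PowerSeries.coeff_mul]
    simp only [narayanaSeries, PowerSeries.coeff_mk, Nat.succ_ne_zero, if_false,
      rightEdgesPoly_succ, map_add, PowerSeries.coeff_C_mul, PowerSeries.coeff_one]
    refine sum_congr rfl fun p _ => ?_
    congr 1
    · split_ifs with h <;> simp [h, rightEdgesPoly_zero]
    · split_ifs with h <;> simp

theorem narayanaSeries_pow_succ (m : ℕ) : narayanaSeries ^ (m + 1) =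
    PowerSeries.X * (narayanaSeries ^ m + narayanaSeries ^ (m + 1) +
      PowerSeries.C X * (narayanaSeries ^ (m + 1) + narayanaSeries ^ (m + 2))) := by
  linear_combination narayanaSeries ^ m * narayanaSeries_eq

/-- The coefficient of `xⁿ tʲ` in the `m`-th power of `narayanaSeries`. -/
noncomputable def narayanaPowCoeff (n m j : ℕ) : ℤ :=
  (PowerSeries.coeff n (narayanaSeries ^ m)).coeff j

theorem narayanaPowCoeff_pow_zero (n j : ℕ) :
    narayanaPowCoeff n 0 j = if n = 0 ∧ j = 0 then 1 else 0 := by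
  rw [narayanaPowCoeff, pow_zero, PowerSeries.coeff_one]
  split_ifs <;> simp_all [Polynomial.coeff_one]

theorem narayanaPowCoeff_zero_succ (m j : ℕ) : narayanaPowCoeff 0 (m + 1) j = 0 := by
  rw [narayanaPowCoeff, narayanaSeries_pow_succ, PowerSeries.coeff_zero_X_mul,
    Polynomial.coeff_zero]

theorem narayanaPowCoeff_succ_succ_zero (n m : ℕ) : narayanaPowCoeff (n + 1) (m + 1) 0 =
    narayanaPowCoeff n m 0 + narayanaPowCoeff n (m + 1) 0 := by
  simp only [narayanaPowCoeff]
  rw [narayanaSeries_pow_succ, PowerSeries.coeff_succ_X_mul, ← narayanaSeries_pow_succ]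
  simp [PowerSeries.coeff_C_mul]

theorem narayanaPowCoeff_succ_succ_succ (n m j : ℕ) : narayanaPowCoeff (n + 1) (m + 1) (j + 1) =
    narayanaPowCoeff n m (j + 1) + narayanaPowCoeff n (m + 1) (j + 1) +
      (narayanaPowCoeff n (m + 1) j + narayanaPowCoeff n (m + 2) j) := by
  simp only [narayanaPowCoeff]
  rw [narayanaSeries_pow_succ, PowerSeries.coeff_succ_X_mul, ← narayanaSeries_pow_succ]
  simp [PowerSeries.coeff_C_mul, Polynomial.coeff_X_mul]

theorem mul_narayanaPowCoeff (n : ℕ) : ∀ m j : ℕ,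
    n * narayanaPowCoeff n m j = m * (n.choose (m + j) * n.choose j) := by
  induction n with
  | zero =>
    rintro (_ | m) j
    · simp
    · simp [Nat.choose_eq_zero_of_lt (show 0 < m + 1 + j by omega)]
  | succ n ih =>
    rintro (_ | m) j
    · simp [narayanaPowCoeff_pow_zero]
    rcases Nat.eq_zero_or_pos n with rfl | hn
    · rcases j with _ | j
      · rw [narayanaPowCoeff_succ_succ_zero]
        rcases m with _ | m
        · simp [narayanaPowCoeff_zero_succ, narayanaPowCoeff_pow_zero]
        · simp [narayanaPowCoeff_zero_succ,
            Nat.choose_eq_zero_of_lt (show 1 < m + 1 + 1 by omega)]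
      · rw [narayanaPowCoeff_succ_succ_succ,
          Nat.choose_eq_zero_of_lt (show 0 + 1 < m + 1 + (j + 1) by omega)]
        rcases m with _ | m <;>
          simp [narayanaPowCoeff_zero_succ, narayanaPowCoeff_pow_zero]
    have hn' : (n : ℤ) ≠ 0 := by exact_mod_cast hn.ne'
    apply mul_left_cancel₀ hn'
    rcases j with _ | j
    · have h₁ := ih m 0
      have h₂ := ih (m + 1) 0
      have h₃ : ((n : ℤ) + 1) * n.choose m = (n + 1).choose (m + 1) * (m + 1) := by
        exact_mod_cast Nat.add_one_mul_choose_eq n m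
      rw [narayanaPowCoeff_succ_succ_zero]
      simp only [add_zero, Nat.choose_zero_right, Nat.choose_succ_succ' n m] at *
      push_cast at *
      linear_combination ((n : ℤ) + 1) * (h₁ + h₂) - h₃
    · have h₁ := ih m (j + 1)
      have h₂ := ih (m + 1) (j + 1)
      have h₃ := ih (m + 1) j
      have h₄ := ih (m + 2) j
      have h₅ : ((n : ℤ) + 1) * n.choose (m + j + 1) =
          (n + 1).choose (m + j + 2) * (m + j + 2) := by
        exact_mod_cast Nat.add_one_mul_choose_eq n (m + j + 1)
      have h₆ : ((n : ℤ) + 1) * n.choose j = (n + 1).choose (j + 1) * (j + 1) := by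
        exact_mod_cast Nat.add_one_mul_choose_eq n j
      rw [narayanaPowCoeff_succ_succ_succ]
      rw [show m + (j + 1) = m + j + 1 by ring] at h₁
      rw [show m + 1 + (j + 1) = m + j + 2 by ring] at *
      rw [show m + 1 + j = m + j + 1 by ring] at h₃
      rw [show m + 2 + j = m + j + 2 by ring] at h₄
      simp only [Nat.choose_succ_succ' n (m + j + 1), Nat.choose_succ_succ' n j] at *
      push_cast at *
      linear_combination ((n : ℤ) + 1) * (h₁ + h₂ + h₃ + h₄)
        - ((n.choose j : ℤ) + n.choose (j + 1)) * h₅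
        + ((n.choose (m + j + 1) : ℤ) + n.choose (m + j + 2)) * h₆

theorem mul_card_rightEdges {n : ℕ} (hn : n ≠ 0) (j : ℕ) :
    n * #{t ∈ treesOfNumNodesEq n | t.rightEdges = j} = n.choose j * n.choose (j + 1) := by
  have h := mul_narayanaPowCoeff n 1 j
  simp only [narayanaPowCoeff, pow_one, narayanaSeries, PowerSeries.coeff_mk, if_neg hn,
    coeff_rightEdgesPoly, Nat.cast_one, one_mul] at h
  rw [mul_comm (n.choose j), add_comm j]
  exact_mod_cast h

/-- The permutation with one-line notation `t.word`. -/
noncomputable def toPerm {n : ℕ} (t : BinaryTree Unit) (ht : t.numNodes = n) :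
    Equiv.Perm (Fin n) :=
  Equiv.ofBijective (fun i => ⟨t.word i, (t.word_lt i (i.2.trans_eq ht.symm)).trans_eq ht⟩)
    (Finite.injective_iff_bijective.mp fun i j h =>
      Fin.ext (t.word_injOn i (i.2.trans_eq ht.symm) j (j.2.trans_eq ht.symm) (by simpa using h)))

theorem coe_toPerm_apply {n : ℕ} (t : BinaryTree Unit) (ht : t.numNodes = n) (i : Fin n) :
    (t.toPerm ht i : ℕ) = t.word i := rfl

theorem toPerm_avoids {n : ℕ} (t : BinaryTree Unit) (ht : t.numNodes = n) :
    avoids231 (t.toPerm ht) := by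
  rintro ⟨i, j, k, hij, hjk, hki, hij'⟩
  exact t.word_avoids i j k hij hjk (k.2.trans_eq ht.symm) hki hij'

theorem des_toPerm {n : ℕ} (t : BinaryTree Unit) (ht : t.numNodes = n) :
    des (t.toPerm ht) = t.rightEdges := by
  subst ht
  rw [← sum_descents_word, ← card_filter, des, ← Nat.card_eq_finsetCard]
  refine Nat.card_congr
    { toFun := fun i => ⟨i.1, ?_⟩
      invFun := fun i => ⟨⟨i.1, ?_⟩, ?_, ?_⟩
      left_inv := fun _ => rfl
      right_inv := fun _ => rfl }
  · obtain ⟨h, h'⟩ := i.2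
    rw [mem_filter, mem_range]
    exact ⟨by omega, h'⟩
  all_goals
    obtain ⟨h, h'⟩ := mem_filter.mp i.2
    rw [mem_range] at h
  · omega
  · simp only
    omega
  · exact h'

theorem maxDrop_toPerm_le {n : ℕ} (t : BinaryTree Unit) (ht : t.numNodes = n) :
    maxDrop (t.toPerm ht) ≤ t.rightEdges := by
  refine Finset.sup_le fun i _ => ?_
  have := t.le_word_add_rightEdges i (i.2.trans_eq ht.symm)
  rw [coe_toPerm_apply]
  omega

theorem exists_toPerm_eq {n : ℕ} (σ : Equiv.Perm (Fin n)) (hσ : avoids231 σ) :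
    ∃ (t : BinaryTree Unit) (ht : t.numNodes = n), t.toPerm ht = σ := by
  obtain ⟨t, ht, h⟩ := exists_word_eq n (fun i => if hi : i < n then σ ⟨i, hi⟩ else 0)
    (fun i hi => by simp [hi])
    (fun i hi j hj h => by
      simp only [hi, hj, dif_pos] at h
      simpa using σ.injective (Fin.ext h))
    (fun i j k hij hjk hk h₁ h₂ => by
      have hj := hjk.trans hk
      have hi := hij.trans hj
      simp only [hi, hj, hk, dif_pos] at h₁ h₂
      exact hσ ⟨⟨i, hi⟩, ⟨j, hj⟩, ⟨k, hk⟩, hij, hjk, h₁, h₂⟩)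
  refine ⟨t, ht, Equiv.ext fun i => Fin.ext ?_⟩
  rw [coe_toPerm_apply, h i i.2]
  simp

theorem toPerm_injective {n : ℕ} {s t : BinaryTree Unit} (hs : s.numNodes = n)
    (ht : t.numNodes = n) (h : s.toPerm hs = t.toPerm ht) : s = t :=
  s.eq_of_word_eq t (hs.trans ht.symm) fun i hi => by
    rw [← coe_toPerm_apply s hs ⟨i, hs ▸ hi⟩, h, coe_toPerm_apply]

theorem card_perm_eq_card_rightEdges {n j k : ℕ} (hk : j ≤ k) :
    a n j k = #{t ∈ treesOfNumNodesEq n | t.rightEdges = j} := by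
  rw [a, ← Nat.card_eq_finsetCard]
  have hmem (t : ({t ∈ treesOfNumNodesEq n | t.rightEdges = j} : Finset _)) :
      t.1.numNodes = n ∧ t.1.rightEdges = j := by
    simpa only [mem_filter, mem_treesOfNumNodesEq] using t.2
  refine (Nat.card_congr (Equiv.ofBijective
    (fun t => ⟨t.1.toPerm (hmem t).1, toPerm_avoids _ _, (des_toPerm _ _).trans (hmem t).2,
      (maxDrop_toPerm_le _ _).trans ((hmem t).2.trans_le hk)⟩)
    ⟨fun s t h => ?_, fun σ => ?_⟩)).symm
  · exact Subtype.ext (toPerm_injective (hmem s).1 (hmem t).1 (congrArg Subtype.val h))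
  · obtain ⟨t, ht, h⟩ := exists_toPerm_eq σ.1 σ.2.1
    refine ⟨⟨t, ?_⟩, Subtype.ext h⟩
    rw [mem_filter, mem_treesOfNumNodesEq]
    exact ⟨ht, by rw [← des_toPerm t ht, h]; exact σ.2.2.1⟩

end BinaryTree

theorem a_eq_narayana (n j k : ℕ) (hn : 1 ≤ n) (hj : 1 ≤ j) (hk : j ≤ k) :
    n * a n j k = n.choose j * n.choose (j + 1) := by
  rw [BinaryTree.card_perm_eq_card_rightEdges hk,
    BinaryTree.mul_card_rightEdges (Nat.one_le_iff_ne_zero.mp hn)]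
end
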